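/- arXiv:2009.08242 — 6 statements merged into one kernel-verified Lean document; each statement's English description precedes it below -/
import Mathlib

section
/- Let g be an odd integer with g ≥ 3 and let G be a simple graph on n vertices whose girth (the length of a shortest cycle of G) is g or g+1. Then P(G,m) − P_DP(G,m) = O(m^{n−g}) as m → ∞; that is, there exist constants C > 0 and N ∈ ℕ such that for every integer m ≥ N, 0 ≤ P(G,m) − P_DP(G,m) ≤ C·m^{n−g}. -/
/-- The number of proper colorings of `G` using colors from `Fin m`
(the chromatic polynomial `P(G,m)`). -/
noncomputable def chromCount {V : Type} (G : SimpleGraph V) (m : ℕ) : ℕ :=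
  Nat.card {f : V → Fin m // ∀ u v : V, G.Adj u v → f u ≠ f v}

/-- `H` is an `m`-fold cover of `G`, where the fiber over `u ∈ V(G)` is `{u} × Fin m`:
each fiber induces a complete graph, cross-edges occur only over edges of `G`, and
the cross-edges over any edge of `G` form a (possibly empty) matching. -/
def IsCover {V : Type} (G : SimpleGraph V) (m : ℕ) (H : SimpleGraph (V × Fin m)) : Prop :=
  (∀ u : V, ∀ i j : Fin m, H.Adj (u, i) (u, j) ↔ i ≠ j) ∧
  (∀ u v : V, ∀ i j : Fin m, u ≠ v → H.Adj (u, i) (v, j) → G.Adj u v) ∧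
  (∀ u v : V, G.Adj u v →
    ∀ i j j' : Fin m, H.Adj (u, i) (v, j) → H.Adj (u, i) (v, j') → j = j')

/-- The number of `(L,H)`-colorings of `G`, i.e. independent sets of `H` meeting
every fiber exactly once (such a set is the image of a function `f : V → Fin m`). -/
noncomputable def dpCoverCount {V : Type} (m : ℕ) (H : SimpleGraph (V × Fin m)) : ℕ :=
  Nat.card {f : V → Fin m // ∀ u v : V, ¬ H.Adj (u, f u) (v, f v)}

/-- The DP color function `P_DP(G,m)`: the minimum number of `(L,H)`-colorings
over all `m`-fold covers of `G`. -/
noncomputable def dpCount {V : Type} (G : SimpleGraph V) (m : ℕ) : ℕ :=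
  sInf {c : ℕ | ∃ H : SimpleGraph (V × Fin m), IsCover G m H ∧ dpCoverCount m H = c}

namespace SimpleGraph

variable {V K : Type*}

theorem edge_mem_edges_of_isCycle_of_length_le {G : SimpleGraph V} {g : ℕ}
    (hG : ∀ (a : V) (w : G.Walk a a), w.IsCycle → g ≤ w.length) {x u v : V} {c : G.Walk x x}
    (hc : c.IsCycle) (hlen : c.length ≤ g) (hu : u ∈ c.support) (hv : v ∈ c.support)
    (huv : G.Adj u v) : s(u, v) ∈ c.edges := by
  classical
  by_contra hne
  have hcr := hc.rotate hu
  have hv' : v ∈ (c.rotate u hu).support := (c.mem_support_rotate_iff u hu).2 hv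
  have hne' : s(u, v) ∉ (c.rotate u hu).edges := fun h => hne ((c.rotate_edges u hu).mem_iff.1 h)
  have hp := hcr.isPath_takeUntil hv'
  have hspec := (c.rotate u hu).take_spec hv'
  have hq : ((c.rotate u hu).dropUntil v hv').IsPath := by
    rw [← hspec] at hcr
    exact hcr.isPath_of_append_right (Walk.not_nil_of_ne huv.ne)
  have h₁ := hG _ _ ((Walk.cons_isCycle_iff _ huv.symm).2 ⟨hp, fun h => hne' (by
    rw [Sym2.eq_swap]
    exact (c.rotate u hu).edges_takeUntil_subset_edges hv' h)⟩)
  have h₂ := hG _ _ ((Walk.cons_isCycle_iff _ huv).2 ⟨hq, fun h => hne'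
    ((c.rotate u hu).edges_dropUntil_subset_edges hv' h)⟩)
  have hsum := congrArg Walk.length hspec
  have hrot : (c.rotate u hu).length = c.length := c.length_rotate u hu
  have h3 := hc.three_le_length
  simp only [Walk.length_append, Walk.length_cons] at hsum h₁ h₂
  omega

theorem Walk.IsCycle.card_support_toFinset [DecidableEq V] {G : SimpleGraph V} {x : V}
    {c : G.Walk x x} (hc : c.IsCycle) : c.support.toFinset.card = c.length := by
  have h : c.support.toFinset = c.support.tail.toFinset := by
    ext v
    rw [List.mem_toFinset, List.mem_toFinset, Walk.mem_support_iff]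
    refine ⟨?_, Or.inr⟩
    rintro (rfl | h)
    · exact Walk.end_mem_tail_support hc.not_nil
    · exact h
  rw [h, List.toFinset_card_of_nodup hc.support_nodup]
  simp

/-- A subgraph with a cycle and an even number of edges has rank at least the odd girth bound `g`:
there are `g` vertices each of which is joined to a vertex outside of them. -/
theorem exists_finset_forall_reachable_notMem {G F : SimpleGraph V} {g : ℕ}
    (hodd : Odd g) (hG : ∀ (a : V) (w : G.Walk a a), w.IsCycle → g ≤ w.length) (hFG : F ≤ G)
    (hF : ¬ F.IsAcyclic) {A : Finset (Sym2 V)} (hA : (A : Set (Sym2 V)) = F.edgeSet)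
    (heven : Even A.card) :
    ∃ D : Finset V, g ≤ D.card ∧ ∀ v ∈ D, ∃ u ∉ D, F.Reachable v u := by
  classical
  simp only [IsAcyclic, not_forall, not_not] at hF
  obtain ⟨x, c, hc⟩ := hF
  have hcG : (c.mapLe hFG).IsCycle := hc.mapLe hFG
  have hg : g ≤ c.length := by simpa using hG _ _ hcG
  have hcard := hc.card_support_toFinset
  have hx : x ∈ c.support.toFinset := by simp
  have hDcard : (c.support.toFinset.erase x).card = c.length - 1 := by
    rw [Finset.card_erase_of_mem hx, hcard]
  have h3 := hc.three_le_length
  have hreach : ∀ v ∈ c.support, F.Reachable v x := fun v hv => ⟨c.dropUntil v hv⟩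
  rcases hg.lt_or_eq with hlt | heq
  · refine ⟨c.support.toFinset.erase x, by omega, fun v hv => ⟨x, by simp, hreach v ?_⟩⟩
    simpa using Finset.mem_of_mem_erase hv
  · obtain ⟨e, heA, hec⟩ : ∃ e ∈ A, e ∉ c.edges.toFinset := by
      by_contra! hsub
      have hAe : A = c.edges.toFinset := by
        refine Finset.Subset.antisymm hsub fun e he => ?_
        rw [← Finset.mem_coe, hA]
        exact c.edges_subset_edgeSet (by simpa using he)
      rw [hAe, List.toFinset_card_of_nodup hc.edges_nodup, c.length_edges, ← heq] at heven
      exact Nat.not_even_iff_odd.2 hodd heven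
    obtain ⟨u, v, huv, hvc, hne⟩ : ∃ u v, F.Adj u v ∧ v ∉ c.support ∧ s(u, v) ∉ c.edges := by
      induction e using Sym2.ind with
      | h u v =>
        have hadj : F.Adj u v := by
          rw [← mem_edgeSet, ← hA]
          exact heA
        have hec' : s(u, v) ∉ c.edges := by simpa using hec
        by_cases hv : v ∈ c.support
        · refine ⟨v, u, hadj.symm, fun hu => hec' ?_, by rwa [Sym2.eq_swap]⟩
          simpa using edge_mem_edges_of_isCycle_of_length_le hG hcG (by simp [heq])
            (by simpa using hu) (by simpa using hv) (hFG hadj)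
        · exact ⟨u, v, hadj, hv, hec'⟩
    refine ⟨insert v (c.support.toFinset.erase x), ?_, fun w hw => ?_⟩
    · rw [Finset.card_insert_of_notMem (by simp [hvc])]
      omega
    · have hxv : x ≠ v := by
        rintro rfl
        exact hvc c.start_mem_support
      rcases Finset.mem_insert.1 hw with rfl | hw
      · by_cases hu : u ∈ c.support
        · exact ⟨x, by simp [hxv], huv.symm.reachable.trans (hreach u hu)⟩
        · exact ⟨u, by simp [hu, huv.ne], huv.symm.reachable⟩
      · exact ⟨x, by simp [hxv], hreach w (by simpa using Finset.mem_of_mem_erase hw)⟩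

theorem IsAcyclic.exists_gauge [Finite V] {F : SimpleGraph V} (hF : F.IsAcyclic)
    {σ : V → V → Equiv.Perm K} (hσ : ∀ u v, σ v u = (σ u v)⁻¹) :
    ∃ φ : V → Equiv.Perm K, ∀ u v, F.Adj u v → σ u v = φ v * (φ u)⁻¹ := by
  classical
  induction F using WellFoundedLT.induction with
  | ind F ih =>
  by_cases hE : ∃ u v, F.Adj u v
  · obtain ⟨a, b, hab⟩ := hE
    have hlt : F.deleteEdges {s(a, b)} < F := by
      refine (deleteEdges_le _).lt_of_ne fun h => ?_
      have : (F.deleteEdges {s(a, b)}).Adj a b := by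
        rw [h]
        exact hab
      simp at this
    have hbridge : ¬ (F.deleteEdges {s(a, b)}).Reachable a b :=
      (isBridge_iff_forall_cycle_notMem (F.mem_edgeSet.2 hab)).2 fun _ p hp => (hF p hp).elim
    obtain ⟨φ, hφ⟩ := ih _ hlt (hF.anti hlt.le)
    refine ⟨fun w => if (F.deleteEdges {s(a, b)}).Reachable b w
      then φ w * ((φ b)⁻¹ * σ a b * φ a) else φ w, fun u v huv => ?_⟩
    have hba : ¬ (F.deleteEdges {s(a, b)}).Reachable b a := fun h => hbridge h.symm
    by_cases he : s(u, v) = s(a, b)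
    · rcases Sym2.eq_iff.1 he with ⟨rfl, rfl⟩ | ⟨rfl, rfl⟩
      · simp [hba, mul_assoc]
      · rw [hσ]
        simp [hba, mul_assoc]
    · have hadj : (F.deleteEdges {s(a, b)}).Adj u v := by
        simpa [deleteEdges_adj, huv] using he
      have hiff : (F.deleteEdges {s(a, b)}).Reachable b u ↔
          (F.deleteEdges {s(a, b)}).Reachable b v :=
        ⟨fun h => h.trans hadj.reachable, fun h => h.trans hadj.symm.reachable⟩
      by_cases hu : (F.deleteEdges {s(a, b)}).Reachable b u
      · simp only [hu, hiff.1 hu, if_true, hφ u v hadj]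
        group
      · simp only [hu, mt hiff.2 hu, if_false, hφ u v hadj]
  · exact ⟨1, fun u v huv => (hE ⟨u, v, huv⟩).elim⟩

variable [Fintype V] [Fintype K]

open Classical in
/-- The maps `f` that the permutations `σ u v` carry along every edge `uv` of `F`. -/
noncomputable def transported (F : SimpleGraph V) (σ : V → V → Equiv.Perm K) :
    Finset (V → K) :=
  {f | ∀ u v, F.Adj u v → σ u v (f u) = f v}

open Classical in
/-- The maps `f` that the permutations `σ u v` do not carry along any edge `uv` of `G`. -/
noncomputable def twistedColorings (G : SimpleGraph V) (σ : V → V → Equiv.Perm K) :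
    Finset (V → K) :=
  {f | ∀ u v, G.Adj u v → σ u v (f u) ≠ f v}

theorem mem_transported {F : SimpleGraph V} {σ : V → V → Equiv.Perm K} {f : V → K} :
    f ∈ F.transported σ ↔ ∀ u v, F.Adj u v → σ u v (f u) = f v := by
  simp [transported]

theorem mem_twistedColorings {G : SimpleGraph V} {σ : V → V → Equiv.Perm K} {f : V → K} :
    f ∈ G.twistedColorings σ ↔ ∀ u v, G.Adj u v → σ u v (f u) ≠ f v := by
  simp [twistedColorings]

theorem eq_of_mem_transported_of_reachable {F : SimpleGraph V} {σ : V → V → Equiv.Perm K}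
    {f f' : V → K} (hf : f ∈ F.transported σ) (hf' : f' ∈ F.transported σ) {u v : V}
    (h : F.Reachable u v) (huv : f u = f' u) : f v = f' v := by
  rw [mem_transported] at hf hf'
  obtain ⟨p⟩ := h
  induction p with
  | nil => exact huv
  | cons h p ih => exact ih (by rw [← hf _ _ h, ← hf' _ _ h, huv])

theorem card_transported_le_card_transported_one (F : SimpleGraph V)
    (σ : V → V → Equiv.Perm K) :
    (F.transported σ).card ≤ (F.transported (1 : V → V → Equiv.Perm K)).card := by
  have hroot : ∀ v, F.Reachable (F.connectedComponentMk v).out v := fun v =>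
    ConnectedComponent.exact (Quot.out_eq _)
  refine Finset.card_le_card_of_injOn (fun f v => f (F.connectedComponentMk v).out) ?_ ?_
  · intro f _
    rw [Finset.mem_coe, mem_transported]
    intro u v huv
    have : F.connectedComponentMk u = F.connectedComponentMk v :=
      ConnectedComponent.sound huv.reachable
    simp [this]
  · intro f hf f' hf' h
    funext v
    exact eq_of_mem_transported_of_reachable hf hf' (hroot v) (congrFun h v)

theorem card_transported_one_le (F : SimpleGraph V) (D : Finset V)
    (hD : ∀ v ∈ D, ∃ u ∉ D, F.Reachable v u) :
    (F.transported (1 : V → V → Equiv.Perm K)).card ≤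
      Fintype.card K ^ (Fintype.card V - D.card) := by
  classical
  calc (F.transported (1 : V → V → Equiv.Perm K)).card
      ≤ (Finset.univ : Finset ({v // v ∈ Dᶜ} → K)).card := by
        refine Finset.card_le_card_of_injOn (fun f v => f v) (by simp) ?_
        intro f hf f' hf' h
        have hout : ∀ u ∉ D, f u = f' u := fun u hu =>
          congrFun h ⟨u, Finset.mem_compl.2 hu⟩
        funext v
        by_cases hv : v ∈ D
        · obtain ⟨u, hu, hvu⟩ := hD v hv
          exact eq_of_mem_transported_of_reachable hf hf' hvu.symm (hout u hu)
        · exact hout v hv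
    _ = Fintype.card K ^ (Fintype.card V - D.card) := by
        rw [Finset.card_univ, Fintype.card_fun, Fintype.card_coe, Finset.card_compl]

theorem IsAcyclic.card_transported {F : SimpleGraph V} (hF : F.IsAcyclic)
    {σ : V → V → Equiv.Perm K} (hσ : ∀ u v, σ v u = (σ u v)⁻¹) :
    (F.transported σ).card = (F.transported (1 : V → V → Equiv.Perm K)).card := by
  obtain ⟨φ, hφ⟩ := hF.exists_gauge hσ
  refine (card_transported_le_card_transported_one F σ).antisymm ?_
  refine Finset.card_le_card_of_injOn (fun f v => φ v (f v)) ?_ ?_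
  · intro f hf
    rw [Finset.mem_coe, mem_transported] at hf ⊢
    intro u v huv
    have := hf u v huv
    simp only [Pi.one_apply, Equiv.Perm.one_apply] at this
    simp [hφ u v huv, this]
  · intro f _ f' _ h
    funext v
    exact (φ v).injective (congrFun h v)

open Classical in
theorem card_twistedColorings_eq_sum (G : SimpleGraph V) {σ : V → V → Equiv.Perm K}
    (hσ : ∀ u v, σ v u = (σ u v)⁻¹) :
    ((G.twistedColorings σ).card : ℤ) = ∑ A ∈ G.edgeFinset.powerset,
      (-1) ^ A.card * (((fromEdgeSet (A : Set (Sym2 V))).transported σ).card : ℤ) := by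
  let S : Sym2 V → Finset (V → K) := fun e =>
    {f | ∀ u v, s(u, v) = e → σ u v (f u) = f v}
  have hS : ∀ u v f, f ∈ S s(u, v) ↔ σ u v (f u) = f v := by
    intro u v f
    simp only [S, Finset.mem_filter, Finset.mem_univ, true_and]
    refine ⟨fun h => h u v rfl, fun h a b hab => ?_⟩
    rcases Sym2.eq_iff.1 hab with ⟨rfl, rfl⟩ | ⟨rfl, rfl⟩
    · exact h
    · rw [hσ, ← h]
      simp
  have hl : G.twistedColorings σ = G.edgeFinset.inf fun e => (S e)ᶜ := by
    ext f
    simp only [mem_twistedColorings, Finset.mem_inf, Finset.mem_compl, Sym2.forall,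
      mem_edgeFinset, mem_edgeSet, hS, ne_eq]
  rw [hl, Finset.inclusion_exclusion_card_inf_compl]
  refine Finset.sum_congr rfl fun A hA => ?_
  congr 3
  ext f
  have hne : ∀ u v, s(u, v) ∈ A → u ≠ v := fun u v h =>
    ((mem_edgeFinset.1 (Finset.mem_powerset.1 hA h)) : G.Adj u v).ne
  simp only [mem_transported, Finset.mem_inf, Sym2.forall, hS, fromEdgeSet_adj, Finset.mem_coe]
  exact ⟨fun h u v huv => h u v huv.1, fun h u v huv => h u v ⟨huv, hne u v huv⟩⟩

theorem card_twistedColorings_one_sub_le {G : SimpleGraph V} {g : ℕ} (hodd : Odd g)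
    (hG : ∀ (a : V) (w : G.Walk a a), w.IsCycle → g ≤ w.length)
    {σ : V → V → Equiv.Perm K} (hσ : ∀ u v, σ v u = (σ u v)⁻¹) [Nonempty K] :
    ((G.twistedColorings (1 : V → V → Equiv.Perm K)).card : ℤ) - (G.twistedColorings σ).card ≤
      2 ^ G.edgeSet.ncard * (Fintype.card K : ℤ) ^ (Fintype.card V - g) := by
  classical
  rw [card_twistedColorings_eq_sum G hσ, card_twistedColorings_eq_sum G (by simp),
    ← Finset.sum_sub_distrib, ← coe_edgeFinset, Set.ncard_coe_finset]
  have hcard : (2 : ℤ) ^ G.edgeFinset.card = G.edgeFinset.powerset.card := by simp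
  rw [hcard, ← nsmul_eq_mul]
  refine Finset.sum_le_card_nsmul _ _ _ fun A hA => ?_
  have hAG : (A : Set (Sym2 V)) ⊆ G.edgeSet := fun e he =>
    mem_edgeFinset.1 (Finset.mem_powerset.1 hA he)
  have hAF : (A : Set (Sym2 V)) = (fromEdgeSet (A : Set (Sym2 V))).edgeSet := by
    rw [edgeSet_fromEdgeSet, eq_comm, sdiff_eq_left, Set.disjoint_left]
    exact fun e he hd => G.not_isDiag_of_mem_edgeSet (hAG he) hd
  have hFG : fromEdgeSet (A : Set (Sym2 V)) ≤ G := by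
    rw [← edgeSet_subset_edgeSet, ← hAF]
    exact hAG
  have hle := card_transported_le_card_transported_one (fromEdgeSet (A : Set (Sym2 V))) σ
  have hpos : (0 : ℤ) ≤ (Fintype.card K : ℤ) ^ (Fintype.card V - g) := by positivity
  rcases Nat.even_or_odd A.card with heven | hAodd
  · by_cases hac : (fromEdgeSet (A : Set (Sym2 V))).IsAcyclic
    · rwa [hac.card_transported hσ, sub_self]
    · obtain ⟨D, hgD, hD⟩ := exists_finset_forall_reachable_notMem hodd hG hFG hac hAF heven
      have h₁ := card_transported_one_le (K := K) _ D hD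
      have h₂ : Fintype.card K ^ (Fintype.card V - D.card) ≤
          Fintype.card K ^ (Fintype.card V - g) :=
        Nat.pow_le_pow_right Fintype.card_pos (by omega)
      have h₃ := h₁.trans h₂
      rw [heven.neg_one_pow]
      zify at h₃
      linarith
  · rw [hAodd.neg_one_pow]
    zify at hle
    linarith

end SimpleGraph

theorem Equiv.Perm.exists_forall_rel_imp_eq {K : Type*} [Finite K] {r : K → K → Prop}
    (h₁ : ∀ i j j', r i j → r i j' → j = j') (h₂ : ∀ i i' j, r i j → r i' j → i = i') :
    ∃ τ : Equiv.Perm K, ∀ i j, r i j → τ i = j := by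
  classical
  have := Fintype.ofFinite K
  choose! F hF using fun (i : K) (hi : ∃ j, r i j) => hi
  have hinj : Function.Injective fun i : {i // ∃ j, r i j} => F i := fun i i' h =>
    Subtype.ext (h₂ _ _ _ (hF i i.2) (by simpa [h] using hF i' i'.2))
  refine ⟨Equiv.extendSubtype (q := (· ∈ Set.range fun i : {i // ∃ j, r i j} => F i))
    (Equiv.ofInjective _ hinj), fun i j hij => ?_⟩
  rw [Equiv.extendSubtype_apply_of_mem _ _ ⟨j, hij⟩]
  exact h₁ i _ _ (hF i ⟨j, hij⟩) hij

theorem IsCover.exists_perm {V : Type} [Finite V] {G : SimpleGraph V} {m : ℕ}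
    {H : SimpleGraph (V × Fin m)} (hH : IsCover G m H) :
    ∃ σ : V → V → Equiv.Perm (Fin m), (∀ u v, σ v u = (σ u v)⁻¹) ∧
      ∀ u v i j, u ≠ v → H.Adj (u, i) (v, j) → σ u v i = j := by
  obtain ⟨-, h₂, h₃⟩ := hH
  have hτ : ∀ u v, ∃ τ : Equiv.Perm (Fin m),
      ∀ i j, (u ≠ v ∧ H.Adj (u, i) (v, j)) → τ i = j := fun u v =>
    Equiv.Perm.exists_forall_rel_imp_eq
      (fun i j j' h h' => h₃ u v (h₂ u v i j h.1 h.2) i j j' h.2 h'.2)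
      (fun i i' j h h' => h₃ v u (h₂ u v i j h.1 h.2).symm j i i' h.2.symm h'.2.symm)
  choose τ hτ using hτ
  obtain ⟨n, ⟨e⟩⟩ := Finite.exists_equiv_fin V
  refine ⟨fun u v => if e u < e v then τ u v else if e v < e u then (τ v u)⁻¹ else 1,
    fun u v => ?_, fun u v i j huv hadj => ?_⟩
  · rcases lt_trichotomy (e u) (e v) with h | h | h
    · simp [h, h.not_gt]
    · simp [h]
    · simp [h, h.not_gt]
  · rcases lt_trichotomy (e u) (e v) with h | h | h
    · simp [h, hτ u v i j ⟨huv, hadj⟩]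
    · exact (huv (e.injective h)).elim
    · simp [h, h.not_gt, Equiv.symm_apply_eq, hτ v u j i ⟨huv.symm, hadj.symm⟩]

theorem IsCover.exists_card_twistedColorings_le {V : Type} [Fintype V] {G : SimpleGraph V} {m : ℕ}
    {H : SimpleGraph (V × Fin m)} (hH : IsCover G m H) :
    ∃ σ : V → V → Equiv.Perm (Fin m), (∀ u v, σ v u = (σ u v)⁻¹) ∧
      (G.twistedColorings σ).card ≤ dpCoverCount m H := by
  classical
  obtain ⟨σ, hσ, hHσ⟩ := hH.exists_perm
  refine ⟨σ, hσ, ?_⟩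
  rw [dpCoverCount, Nat.card_eq_fintype_card, Fintype.card_subtype]
  refine Finset.card_le_card fun f hf => ?_
  simp only [SimpleGraph.twistedColorings, Finset.mem_filter, Finset.mem_univ, true_and] at hf ⊢
  intro u v hadj
  have huv : u ≠ v := by
    rintro rfl
    exact hadj.ne rfl
  exact hf u v (hH.2.1 u v _ _ huv hadj) (hHσ u v _ _ huv hadj)

theorem chromCount_eq_card_twistedColorings {V : Type} [Fintype V] (G : SimpleGraph V) (m : ℕ) :
    chromCount G m = (G.twistedColorings (1 : V → V → Equiv.Perm (Fin m))).card := by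
  classical
  rw [chromCount, Nat.card_eq_fintype_card, Fintype.card_subtype]
  refine congrArg Finset.card ?_
  ext f
  simp [SimpleGraph.mem_twistedColorings]

/-- The cover of `G` whose colorings are the proper colorings of `G`. -/
theorem exists_isCover_dpCoverCount_eq_chromCount {V : Type} (G : SimpleGraph V) (m : ℕ) :
    ∃ H : SimpleGraph (V × Fin m), IsCover G m H ∧ dpCoverCount m H = chromCount G m := by
  let H : SimpleGraph (V × Fin m) :=
    { Adj := fun x y => (x.1 = y.1 ∧ x.2 ≠ y.2) ∨ (G.Adj x.1 y.1 ∧ x.2 = y.2)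
      symm := ⟨fun x y h => h.imp (fun h => ⟨h.1.symm, h.2.symm⟩) fun h => ⟨h.1.symm, h.2.symm⟩⟩
      loopless := ⟨fun x h => by simp at h⟩ }
  refine ⟨H, ⟨fun u i j => by simp [H], fun u v i j huv h => ?_, fun u v huv i j j' h h' => ?_⟩, ?_⟩
  · simpa [H, huv] using And.left (b := i = j) (by simpa [H, huv] using h)
  · have hj : i = j := by simpa [H, huv.ne, huv] using h
    have hj' : i = j' := by simpa [H, huv.ne, huv] using h'
    exact hj.symm.trans hj'
  · refine Nat.card_congr (Equiv.subtypeEquivRight fun f => ?_)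
    simp only [H, not_or, not_and, not_not]
    exact ⟨fun h u v => (h u v).2, fun h u v => ⟨fun huv => congrArg f huv, h u v⟩⟩

theorem stmt0 {V : Type} [Fintype V] (G : SimpleGraph V) (n g : ℕ)
    (hn : Fintype.card V = n) (hg : 3 ≤ g) (hodd : Odd g)
    (hgirth : G.egirth = (g : ℕ∞) ∨ G.egirth = (g : ℕ∞) + 1) :
    ∃ (C : ℝ) (N : ℕ), 0 < C ∧ ∀ m : ℕ, N ≤ m →
      0 ≤ (chromCount G m : ℝ) - (dpCount G m : ℝ) ∧
      (chromCount G m : ℝ) - (dpCount G m : ℝ) ≤ C * (m : ℝ) ^ ((n : ℤ) - (g : ℤ)) := by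
  have hle_egirth : (g : ℕ∞) ≤ G.egirth := by
    rcases hgirth with h | h <;> simp [h]
  have hG : ∀ (a : V) (w : G.Walk a a), w.IsCycle → g ≤ w.length := fun a w hw => by
    exact_mod_cast hle_egirth.trans (SimpleGraph.egirth_le_length hw)
  have hgn : g ≤ n := by
    classical
    have hcyc : ¬ G.IsAcyclic := fun h => by
      rw [h.egirth_eq_top] at hgirth
      rcases hgirth with h | h
      · exact ENat.top_ne_natCast g h
      · exact ENat.top_ne_natCast (g + 1) (by exact_mod_cast h)
    obtain ⟨a, w, hw, -⟩ := SimpleGraph.exists_egirth_eq_length.2 hcyc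
    rw [← hn]
    exact (hG a w hw).trans (hw.card_support_toFinset ▸ Finset.card_le_univ _)
  refine ⟨2 ^ G.edgeSet.ncard, 1, by positivity, fun m hm => ?_⟩
  obtain ⟨H₀, hH₀, hcount⟩ := exists_isCover_dpCoverCount_eq_chromCount G m
  constructor
  · have : dpCount G m ≤ chromCount G m := Nat.sInf_le ⟨H₀, hH₀, hcount⟩
    rw [sub_nonneg]
    exact_mod_cast this
  · obtain ⟨H, hH, hmin⟩ : ∃ H : SimpleGraph (V × Fin m),
        IsCover G m H ∧ dpCoverCount m H = dpCount G m :=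
      Nat.sInf_mem (s := {c | ∃ H, IsCover G m H ∧ dpCoverCount m H = c}) ⟨_, H₀, hH₀, rfl⟩
    obtain ⟨σ, hσ, hle⟩ := hH.exists_card_twistedColorings_le
    have : Nonempty (Fin m) := ⟨⟨0, hm⟩⟩
    have key := SimpleGraph.card_twistedColorings_one_sub_le hodd hG hσ
    rw [← chromCount_eq_card_twistedColorings, Fintype.card_fin, hn] at key
    have hbound : (chromCount G m : ℤ) - dpCount G m ≤
        2 ^ G.edgeSet.ncard * (m : ℤ) ^ (n - g) := by
      rw [← hmin]
      zify at hle
      linarith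
    rw [← Nat.cast_sub hgn, zpow_natCast]
    exact_mod_cast hbound
end

section
/- For any simple graph M on n vertices, P(M,m) − P_DP(M,m) = O(m^{n−3}) as m → ∞; that is, there exist constants C > 0 and N ∈ ℕ such that for every integer m ≥ N, 0 ≤ P(M,m) − P_DP(M,m) ≤ C·m^{n−3}. -/
/-- A partial matching between two copies of a finite type extends to a permutation. -/
theorem exists_perm_extending {α : Type*} [Fintype α] (R : α → α → Prop)
    (h₁ : ∀ i c c', R i c → R i c' → c = c') (h₂ : ∀ i i' c, R i c → R i' c → i = i') :
    ∃ τ : Equiv.Perm α, ∀ i c, R i c → τ i = c := by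
  classical
  let f : α → α := fun i => if h : ∃ c, R i c then h.choose else i
  have hf : ∀ i c, R i c → f i = c := by
    intro i c hic
    have h : ∃ c, R i c := ⟨c, hic⟩
    simp only [f, dif_pos h]
    exact h₁ i _ _ h.choose_spec hic
  obtain ⟨g, hg⟩ := Finset.exists_equiv_extend_of_card_eq (α := α) (β := α)
    (t := Finset.univ) Finset.card_univ.symm (s := {i | ∃ c, R i c}) (f := f)
    (Finset.subset_univ _) (by
      intro i hi j hj hij
      simp only [Finset.coe_filter, Finset.mem_univ, true_and, Set.mem_ofPred_eq] at hi hj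
      obtain ⟨c, hc⟩ := hi
      obtain ⟨c', hc'⟩ := hj
      rw [hf i c hc, hf j c' hc'] at hij
      subst hij
      exact h₂ i j c hc hc')
  refine ⟨g.trans (Equiv.subtypeUnivEquiv (by simp)), fun i c hic => ?_⟩
  rw [← hf i c hic, ← hg i (by simpa using ⟨c, hic⟩)]
  rfl

/-- A family of functions whose members are determined by their values off two points
has at most `m ^ (|ι| - 2)` members. -/
theorem card_mul_sq_le_of_determined {ι : Type*} [Fintype ι] [DecidableEq ι] {m : ℕ}
    (T : Finset (ι → Fin m)) (p q : ι) (hpq : p ≠ q)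
    (hT : ∀ f ∈ T, ∀ g ∈ T, (∀ z, z ≠ p → z ≠ q → f z = g z) → f = g) :
    T.card * m ^ 2 ≤ m ^ Fintype.card ι := by
  have key : (T ×ˢ (Finset.univ : Finset (Fin m × Fin m))).card
      ≤ (Finset.univ : Finset (ι → Fin m)).card := by
    refine Finset.card_le_card_of_injOn
      (fun t => Function.update (Function.update t.1 p t.2.1) q t.2.2) (by simp) ?_
    rintro ⟨f, i, j⟩ hf ⟨g, i', j'⟩ hg h
    simp only [Finset.coe_product, Finset.coe_univ, Set.mem_prod, Finset.mem_coe, Set.mem_univ,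
      and_true] at hf hg
    have hq := congrFun h q
    have hp := congrFun h p
    simp only [Function.update_self, Function.update_of_ne hpq] at hp hq
    have hfg : f = g := by
      refine hT f hf g hg fun z hzp hzq => ?_
      have hz := congrFun h z
      simpa only [Function.update_of_ne hzp, Function.update_of_ne hzq] using hz
    subst hfg hp hq
    rfl
  simpa [Finset.card_product, sq] using key

/-- Two matching constraints on distinct pairs of coordinates leave at most `m ^ (|ι| - 2)`
functions. -/
theorem card_mul_sq_le_of_two_matchings {ι : Type*} [Fintype ι] [DecidableEq ι] {m : ℕ}
    (T : Finset (ι → Fin m)) {x y z w : ι} (R S : Fin m → Fin m → Prop)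
    (hxy : x ≠ y) (hzw : z ≠ w) (hne : ¬ (x = z ∧ y = w)) (hne' : ¬ (x = w ∧ y = z))
    (hR : ∀ i i' j, R i j → R i' j → i = i')
    (hS₁ : ∀ i j j', S i j → S i j' → j = j') (hS₂ : ∀ i i' j, S i j → S i' j → i = i')
    (hT : ∀ f ∈ T, R (f x) (f y) ∧ S (f z) (f w)) :
    T.card * m ^ 2 ≤ m ^ Fintype.card ι := by
  by_cases hz : z ≠ x ∧ z ≠ y
  · refine card_mul_sq_le_of_determined T z x hz.1 fun f hf g hg h => ?_
    have hy : f y = g y := h y hz.2.symm hxy.symm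
    have hx : f x = g x := hR _ _ (f y) (hT f hf).1 (hy ▸ (hT g hg).1)
    have hw : f w = g w := by
      by_cases hwx : w = x
      · rw [hwx, hx]
      · exact h w hzw.symm hwx
    have hz' : f z = g z := hS₂ _ _ (f w) (hT f hf).2 (hw ▸ (hT g hg).2)
    funext t
    by_cases htz : t = z
    · rw [htz, hz']
    by_cases htx : t = x
    · rw [htx, hx]
    exact h t htz htx
  · have hw : w ≠ x ∧ w ≠ y := by grind
    refine card_mul_sq_le_of_determined T w x hw.1 fun f hf g hg h => ?_
    have hy : f y = g y := h y hw.2.symm hxy.symm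
    have hx : f x = g x := hR _ _ (f y) (hT f hf).1 (hy ▸ (hT g hg).1)
    have hz : f z = g z := by
      by_cases hzx : z = x
      · rw [hzx, hx]
      · exact h z hzw hzx
    have hw' : f w = g w := hS₁ (f z) _ _ (hT f hf).2 (hz ▸ (hT g hg).2)
    funext t
    by_cases htw : t = w
    · rw [htw, hw']
    by_cases htx : t = x
    · rw [htx, hx]
    exact h t htw htx

/-- The number of collisions of `f` on `S` is at least `|S| - |f(S)|`. -/
theorem card_le_card_image_add_collisions {ι α : Type*} [LinearOrder ι] [DecidableEq α]
    (S : Finset ι) (f : ι → α) :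
    S.card ≤ (S.image f).card + {p ∈ S ×ˢ S | p.1 < p.2 ∧ f p.1 = f p.2}.card := by
  induction S using Finset.induction_on_max with
  | empty => simp
  | insert a S ha ih =>
    have haS : a ∉ S := fun h => lt_irrefl _ (ha a h)
    rw [Finset.card_insert_of_notMem haS, Finset.image_insert]
    have hsub : {p ∈ S ×ˢ S | p.1 < p.2 ∧ f p.1 = f p.2} ⊆
        {p ∈ insert a S ×ˢ insert a S | p.1 < p.2 ∧ f p.1 = f p.2} := by
      intro p
      simp only [Finset.mem_filter, Finset.mem_product, Finset.mem_insert]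
      tauto
    by_cases h : f a ∈ S.image f
    · rw [Finset.insert_eq_of_mem h]
      obtain ⟨y, hy, hya⟩ := Finset.mem_image.1 h
      have hlt := Finset.card_lt_card (Finset.ssubset_iff_subset_ne.2 ⟨hsub, fun heq => by
        have : (y, a) ∈ {p ∈ S ×ˢ S | p.1 < p.2 ∧ f p.1 = f p.2} := by
          rw [heq]
          simp [hy, hya, ha y hy]
        simp [haS] at this⟩)
      omega
    · rw [Finset.card_insert_of_notMem h]
      have := Finset.card_le_card hsub
      omega

/-- Counting functions on `Fin (n + 1)` by their restrictions to the last `n` coordinates. -/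
theorem card_filter_cons {n m : ℕ} (P : (Fin (n + 1) → Fin m) → Prop)
    (P' : (Fin n → Fin m) → Prop) [DecidablePred P] [DecidablePred P']
    (F : (Fin n → Fin m) → Finset (Fin m))
    (h : ∀ c g, P (Fin.cons c g) ↔ P' g ∧ c ∉ F g) :
    (({f | P f} : Finset (Fin (n + 1) → Fin m)).card : ℤ) = ∑ g with P' g, ((m : ℤ) - (F g).card) := by
  classical
  rw [Finset.card_filter, Nat.cast_sum,
    ← Equiv.sum_comp (Fin.consEquiv fun _ : Fin (n + 1) => Fin m), Fintype.sum_prod_type_right,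
    Finset.sum_filter]
  refine Finset.sum_congr rfl fun g _ => ?_
  have hc : ((Finset.univ.filter fun c => c ∉ F g).card : ℤ) = (m : ℤ) - (F g).card := by
    rw [Finset.filter_not, Finset.filter_mem_eq_inter, Finset.univ_inter,
      Finset.card_sdiff_of_subset (Finset.subset_univ _), Finset.card_univ, Fintype.card_fin,
      Nat.cast_sub (card_finset_fin_le _)]
  by_cases hg : P' g
  · rw [if_pos hg, ← hc, Finset.card_filter, Nat.cast_sum]
    refine Finset.sum_congr rfl fun c _ => ?_
    have := h c g
    change ((if P (Fin.cons c g) then 1 else 0 : ℕ) : ℤ) = _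
    simp only [this, hg, true_and]
  · rw [if_neg hg]
    refine Finset.sum_eq_zero fun c _ => ?_
    have := h c g
    change ((if P (Fin.cons c g) then 1 else 0 : ℕ) : ℤ) = 0
    simp [this, hg]

theorem chromCount_eq_card_filter {V : Type} [Fintype V] (G : SimpleGraph V) (m : ℕ)
    [DecidableEq V] [DecidablePred fun f : V → Fin m => ∀ u v : V, G.Adj u v → f u ≠ f v] :
    chromCount G m = ({f | ∀ u v : V, G.Adj u v → f u ≠ f v} : Finset (V → Fin m)).card := by
  rw [chromCount, Nat.card_eq_fintype_card, Fintype.card_subtype]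

theorem dpCoverCount_eq_card_filter {V : Type} [Fintype V] (m : ℕ) (H : SimpleGraph (V × Fin m))
    [DecidableEq V] [DecidablePred fun f : V → Fin m => ∀ u v : V, ¬ H.Adj (u, f u) (v, f v)] :
    dpCoverCount m H =
      ({f | ∀ u v : V, ¬ H.Adj (u, f u) (v, f v)} : Finset (V → Fin m)).card := by
  rw [dpCoverCount, Nat.card_eq_fintype_card, Fintype.card_subtype]

theorem IsCover.comap {V W : Type} {G : SimpleGraph V} {m : ℕ} {H : SimpleGraph (V × Fin m)}
    (hH : IsCover G m H) {φ : W → V} (hφ : Function.Injective φ) :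
    IsCover (G.comap φ) m (H.comap (Prod.map φ id)) := by
  refine ⟨fun u i j => hH.1 (φ u) i j, fun u v i j huv h => ?_, fun u v huv i j j' h h' => ?_⟩
  · exact hH.2.1 (φ u) (φ v) i j (hφ.ne huv) h
  · exact hH.2.2 (φ u) (φ v) huv i j j' h h'

/-- Between two distinct fibers, a cover has at most one edge at each vertex. -/
theorem IsCover.eq_of_adj {V : Type} {G : SimpleGraph V} {m : ℕ} {H : SimpleGraph (V × Fin m)}
    (hH : IsCover G m H) {u v : V} (huv : u ≠ v) {i j j' : Fin m}
    (h : H.Adj (u, i) (v, j)) (h' : H.Adj (u, i) (v, j')) : j = j' :=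
  hH.2.2 u v (hH.2.1 u v i j huv h) i j j' h h'

theorem chromCount_comap_equiv {V W : Type} (G : SimpleGraph V) (m : ℕ) (e : W ≃ V) :
    chromCount (G.comap e) m = chromCount G m := by
  refine Nat.card_congr (Equiv.subtypeEquiv (Equiv.arrowCongr e (Equiv.refl _)) fun f => ?_)
  constructor
  · intro h u v huv
    exact h (e.symm u) (e.symm v) (by simpa using huv)
  · intro h u v huv
    simpa using h (e u) (e v) huv

theorem dpCoverCount_comap_equiv {V W : Type} (m : ℕ) (H : SimpleGraph (V × Fin m)) (e : W ≃ V) :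
    dpCoverCount m (H.comap (Prod.map e id)) = dpCoverCount m H := by
  refine Nat.card_congr (Equiv.subtypeEquiv (Equiv.arrowCongr e (Equiv.refl _)) fun f => ?_)
  constructor
  · intro h u v huv
    exact h (e.symm u) (e.symm v) (by simpa using huv)
  · intro h u v huv
    exact h (e u) (e v) (by simpa using huv)

/-- The cover whose colorings are exactly the proper colorings of `G`. -/
def canonicalCover {V : Type} (G : SimpleGraph V) (m : ℕ) : SimpleGraph (V × Fin m) where
  Adj a b := (a.1 = b.1 ∧ a.2 ≠ b.2) ∨ (G.Adj a.1 b.1 ∧ a.2 = b.2)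
  symm := ⟨fun a b h => h.imp (fun h => ⟨h.1.symm, h.2.symm⟩) fun h => ⟨h.1.symm, h.2.symm⟩⟩
  loopless := ⟨fun a h => by simp at h⟩

theorem isCover_canonicalCover {V : Type} (G : SimpleGraph V) (m : ℕ) :
    IsCover G m (canonicalCover G m) := by
  refine ⟨fun u i j => by simp [canonicalCover], fun u v i j huv h => ?_,
    fun u v huv i j j' h h' => ?_⟩
  · simp only [canonicalCover] at h
    tauto
  · have := huv.ne
    simp only [canonicalCover] at h h'
    grind

theorem dpCoverCount_canonicalCover {V : Type} (G : SimpleGraph V) (m : ℕ) :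
    dpCoverCount m (canonicalCover G m) = chromCount G m := by
  refine Nat.card_congr (Equiv.subtypeEquivRight fun f => ?_)
  refine forall_congr' fun u => forall_congr' fun v => ?_
  simp only [canonicalCover]
  grind

/-- Double counting of a relation, with integer-valued cardinalities. -/
theorem sum_card_filter_comm {α β : Type*} (S : Finset α) (T : Finset β) (r : α → β → Prop)
    [∀ a b, Decidable (r a b)] :
    ∑ a ∈ S, ({b ∈ T | r a b}.card : ℤ) = ∑ b ∈ T, ({a ∈ S | r a b}.card : ℤ) := by
  exact_mod_cast Finset.sum_card_bipartiteAbove_eq_sum_card_bipartiteBelow r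

/-- Removing vertex `0` from `G`: in passing from `G` minus the vertex to `G`, the
deficiency of a cover is multiplied by at most `m - d`, up to an error `O(m ^ (n - 2))`. -/
theorem chromCount_sub_dpCoverCount_le_of_succ {n : ℕ} (G : SimpleGraph (Fin (n + 1))) :
    ∃ d C : ℕ, d ≤ n ∧ ∀ (m : ℕ) (H : SimpleGraph (Fin (n + 1) × Fin m)), IsCover G m H →
      ((chromCount G m : ℤ) - dpCoverCount m H) * m ^ 2 ≤
        (m - d) * ((chromCount (G.comap Fin.succ) m : ℤ) -
          dpCoverCount m (H.comap (Prod.map Fin.succ id))) * m ^ 2 + C * m ^ n := by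
  classical
  set G' := G.comap Fin.succ with hG'
  let N : Finset (Fin n) := {x | G.Adj 0 x.succ}
  let Q : Finset (Fin n × Fin n) := {p ∈ N ×ˢ N | p.1 < p.2 ∧ ¬ G'.Adj p.1 p.2}
  let E : Finset (Fin n × Fin n) := {p | G'.Adj p.1 p.2}
  have hQ : ∀ p ∈ Q, p.1 ∈ N ∧ p.2 ∈ N ∧ p.1 < p.2 ∧ ¬ G'.Adj p.1 p.2 := by
    intro p hp
    simpa [Q, and_assoc] using hp
  refine ⟨N.card, Q.card * E.card + Q.offDiag.card, by simpa using card_finset_fin_le N,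
    fun m H hH => ?_⟩
  have hH' := hH.comap (Fin.succ_injective n)
  rw [← hG'] at hH'
  set H' := H.comap (Prod.map (Fin.succ : Fin n → Fin (n + 1)) (id : Fin m → Fin m)) with hH'def
  have hτ : ∀ x : Fin n, ∃ τ : Equiv.Perm (Fin m),
      ∀ i c, H.Adj (0, c) (x.succ, i) → τ i = c := fun x =>
    exists_perm_extending (fun i c => H.Adj (0, c) (x.succ, i))
      (fun i c c' h h' => hH.eq_of_adj (Fin.succ_ne_zero x) h.symm h'.symm)
      (fun i i' c h h' => hH.eq_of_adj (Fin.succ_ne_zero x).symm h h')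
  choose τ hτ using hτ
  let coin (g : Fin n → Fin m) (p : Fin n × Fin n) : Prop := τ p.1 (g p.1) = τ p.2 (g p.2)
  let A : Finset (Fin n → Fin m) := {g | ∀ u v, G'.Adj u v → g u ≠ g v}
  let B : Finset (Fin n → Fin m) := {g | ∀ u v, ¬ H'.Adj (u, g u) (v, g v)}
  have hA : chromCount G' m = A.card := chromCount_eq_card_filter G' m
  have hB : dpCoverCount m H' = B.card := dpCoverCount_eq_card_filter m H'
  have hG : (chromCount G m : ℤ) = ∑ g ∈ A, ((m : ℤ) - (N.image g).card) := by
    rw [chromCount_eq_card_filter]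
    refine card_filter_cons _ _ _ fun c g => ?_
    simp only [Fin.forall_fin_succ, Fin.cons_zero, Fin.cons_succ, N, Finset.mem_image,
      Finset.mem_filter, Finset.mem_univ, true_and, hG', SimpleGraph.comap_adj]
    grind [SimpleGraph.irrefl, SimpleGraph.adj_comm]
  let F (g : Fin n → Fin m) : Finset (Fin m) := {c | ∃ x : Fin n, H.Adj (0, c) (x.succ, g x)}
  have hHF : (dpCoverCount m H : ℤ) = ∑ g ∈ B, ((m : ℤ) - (F g).card) := by
    rw [dpCoverCount_eq_card_filter]
    refine card_filter_cons _ _ _ fun c g => ?_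
    simp only [Fin.forall_fin_succ, Fin.cons_zero, Fin.cons_succ, F,
      Finset.mem_filter, Finset.mem_univ, true_and, hH'def, SimpleGraph.comap_adj, Prod.map, id]
    grind [SimpleGraph.irrefl, SimpleGraph.adj_comm]
  have hchrom : (chromCount G m : ℤ) ≤ (m - N.card) * A.card +
      ∑ p ∈ Q, (({g | g p.1 = g p.2} : Finset (Fin n → Fin m)).card : ℤ) := by
    have hpt : ∀ g ∈ A, ((m : ℤ) - (N.image g).card) ≤
        (m - N.card) + ({p ∈ Q | g p.1 = g p.2}.card : ℤ) := by
      intro g hg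
      have h := card_le_card_image_add_collisions N g
      have hsub : {p ∈ N ×ˢ N | p.1 < p.2 ∧ g p.1 = g p.2} ⊆ {p ∈ Q | g p.1 = g p.2} := by
        intro p
        simp only [A, Finset.mem_filter, Finset.mem_univ, true_and] at hg
        simp only [Q, Finset.mem_filter]
        rintro ⟨h₁, h₂, h₃⟩
        exact ⟨⟨h₁, h₂, fun hadj => hg _ _ hadj h₃⟩, h₃⟩
      have := Finset.card_le_card hsub
      omega
    rw [hG]
    refine (Finset.sum_le_sum hpt).trans ?_
    rw [Finset.sum_add_distrib, Finset.sum_const, nsmul_eq_mul, mul_comm]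
    gcongr
    rw [sum_card_filter_comm]
    gcongr with p
    exact A.subset_univ
  have hpt : ∀ g, (m - N.card : ℤ) + ({p ∈ Q | coin g p}.card : ℤ) -
      ({r ∈ Q.offDiag | coin g r.1 ∧ coin g r.2}.card : ℤ) ≤ (m : ℤ) - (F g).card := by
    intro g
    have hFsub : F g ⊆ N.image fun x => τ x (g x) := by
      intro c hc
      simp only [F, Finset.mem_filter, Finset.mem_univ, true_and] at hc
      obtain ⟨x, hx⟩ := hc
      refine Finset.mem_image.2 ⟨x, ?_, hτ x _ _ hx⟩
      simpa [N] using hH.2.1 _ _ _ _ (Fin.succ_ne_zero x).symm hx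
    have hF := Finset.card_le_card hFsub
    have hoff : {r ∈ Q.offDiag | coin g r.1 ∧ coin g r.2} = {p ∈ Q | coin g p}.offDiag := by
      ext r
      simp only [Finset.mem_filter, Finset.mem_offDiag]
      tauto
    rw [hoff, Finset.offDiag_card, Nat.cast_sub (Nat.le_mul_self _)]
    rcases Finset.eq_empty_or_nonempty {p ∈ Q | coin g p} with h0 | ⟨p, hp⟩
    · have := Finset.card_image_le (s := N) (f := fun x => τ x (g x))
      rw [h0]
      simp
      omega
    · have hpos : 0 < {p ∈ Q | coin g p}.card := Finset.card_pos.2 ⟨p, hp⟩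
      obtain ⟨hpQ, hpc⟩ := Finset.mem_filter.1 hp
      obtain ⟨h₁, h₂, h₃, -⟩ := hQ p hpQ
      have hlt : (N.image fun x => τ x (g x)).card < N.card := by
        refine lt_of_le_of_ne Finset.card_image_le fun heq => ?_
        exact h₃.ne (Finset.card_image_iff.1 heq h₁ h₂ hpc)
      push_cast
      nlinarith
  have hdp : (m - N.card : ℤ) * B.card + ∑ p ∈ Q, ({g ∈ B | coin g p}.card : ℤ) -
      ∑ r ∈ Q.offDiag, ({g ∈ B | coin g r.1 ∧ coin g r.2}.card : ℤ) ≤ dpCoverCount m H := by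
    rw [hHF]
    refine le_trans (le_of_eq ?_) (Finset.sum_le_sum fun g _ => hpt g)
    rw [Finset.sum_sub_distrib, Finset.sum_add_distrib, Finset.sum_const, nsmul_eq_mul,
      mul_comm (B.card : ℤ), sum_card_filter_comm B Q coin,
      sum_card_filter_comm B Q.offDiag fun g r => coin g r.1 ∧ coin g r.2]
  have hcoin : ∀ p, ({g | coin g p} : Finset (Fin n → Fin m)).card =
      ({g | g p.1 = g p.2} : Finset (Fin n → Fin m)).card := by
    intro p
    refine Finset.card_equiv (Equiv.piCongrRight τ) fun g => ?_
    simp [coin]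
  have hpair : ∀ p ∈ Q, (({g | g p.1 = g p.2} : Finset (Fin n → Fin m)).card : ℤ) * m ^ 2 ≤
      ({g ∈ B | coin g p}.card : ℤ) * m ^ 2 + E.card * m ^ n := by
    intro p hp
    obtain ⟨-, -, hlt, hnadj⟩ := hQ p hp
    have hsub : ({g | coin g p} : Finset (Fin n → Fin m)) ⊆ {g ∈ B | coin g p} ∪
        E.biUnion fun e => {g | coin g p ∧ H'.Adj (e.1, g e.1) (e.2, g e.2)} := by
      intro g hg
      simp only [Finset.mem_filter, Finset.mem_univ, true_and] at hg
      by_cases hgB : g ∈ B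
      · simp [hgB, hg]
      · simp only [B, Finset.mem_filter, Finset.mem_univ, true_and, not_forall, not_not] at hgB
        obtain ⟨u, v, huv⟩ := hgB
        have hne : u ≠ v := by
          rintro rfl
          exact H'.irrefl huv
        refine Finset.mem_union_right _ (Finset.mem_biUnion.2 ⟨(u, v), ?_, ?_⟩)
        · simpa only [E, Finset.mem_filter, Finset.mem_univ, true_and] using
            hH'.2.1 u v _ _ hne huv
        · simpa only [Finset.mem_filter, Finset.mem_univ, true_and] using ⟨hg, huv⟩
    have hcard := (Finset.card_le_card hsub).trans (Finset.card_union_le _ _)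
    have hbad : (E.biUnion fun e => ({g | coin g p ∧ H'.Adj (e.1, g e.1) (e.2, g e.2)} :
        Finset (Fin n → Fin m))).card * m ^ 2 ≤ E.card * m ^ n := by
      refine (Nat.mul_le_mul_right _ Finset.card_biUnion_le).trans ?_
      rw [Finset.sum_mul, ← smul_eq_mul (a := E.card)]
      refine Finset.sum_le_card_nsmul _ _ _ fun e he => ?_
      have hadj : G'.Adj e.1 e.2 := by
        simpa only [E, Finset.mem_filter, Finset.mem_univ, true_and] using he
      have := card_mul_sq_le_of_two_matchings
        ({g | coin g p ∧ H'.Adj (e.1, g e.1) (e.2, g e.2)} : Finset (Fin n → Fin m))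
        (x := p.1) (y := p.2) (z := e.1) (w := e.2)
        (fun i j => τ p.1 i = τ p.2 j) (fun i j => H'.Adj (e.1, i) (e.2, j)) hlt.ne hadj.ne
        (fun h => hnadj (by rw [h.1, h.2]; exact hadj))
        (fun h => hnadj (by rw [h.1, h.2]; exact hadj.symm))
        (fun i i' j h h' => (τ p.1).injective (h.trans h'.symm))
        (fun i j j' h h' => hH'.eq_of_adj hadj.ne h h')
        (fun i i' j h h' => hH'.eq_of_adj hadj.ne.symm h.symm h'.symm)
        (fun g hg => (Finset.mem_filter.1 hg).2)
      simpa using this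
    rw [hcoin p] at hcard
    have := Nat.mul_le_mul_right (m ^ 2) hcard
    rw [add_mul] at this
    exact_mod_cast this.trans (Nat.add_le_add_left hbad _)
  have htriple : ∀ r ∈ Q.offDiag, ({g ∈ B | coin g r.1 ∧ coin g r.2}.card : ℤ) * m ^ 2 ≤ m ^ n := by
    intro r hr
    obtain ⟨h₁, h₂, hne⟩ := Finset.mem_offDiag.1 hr
    obtain ⟨-, -, hlt₁, -⟩ := hQ _ h₁
    obtain ⟨-, -, hlt₂, -⟩ := hQ _ h₂
    have := card_mul_sq_le_of_two_matchings {g ∈ B | coin g r.1 ∧ coin g r.2}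
      (x := r.1.1) (y := r.1.2) (z := r.2.1) (w := r.2.2)
      (fun i j => τ r.1.1 i = τ r.1.2 j) (fun i j => τ r.2.1 i = τ r.2.2 j) hlt₁.ne hlt₂.ne
      (fun h => hne (Prod.ext h.1 h.2))
      (fun h => lt_asymm hlt₁ (by rw [h.1, h.2]; exact hlt₂))
      (fun i i' j h h' => (τ r.1.1).injective (h.trans h'.symm))
      (fun i j j' h h' => (τ r.2.2).injective (h.symm.trans h'))
      (fun i i' j h h' => (τ r.2.1).injective (h.trans h'.symm))
      (fun g hg => (Finset.mem_filter.1 hg).2)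
    rw [Fintype.card_fin] at this
    exact_mod_cast this
  have hpairs := Finset.sum_le_sum hpair
  have htriples := Finset.sum_le_sum htriple
  rw [Finset.sum_add_distrib, ← Finset.sum_mul, ← Finset.sum_mul, Finset.sum_const,
    nsmul_eq_mul] at hpairs
  rw [← Finset.sum_mul, Finset.sum_const, nsmul_eq_mul] at htriples
  have hm : (0 : ℤ) ≤ (m : ℤ) ^ 2 := by positivity
  have h₁ := mul_le_mul_of_nonneg_right hchrom hm
  have h₂ := mul_le_mul_of_nonneg_right hdp hm
  rw [hA, hB]
  push_cast
  linarith

/-- Every cover has at least `P(G,m) - O(m ^ (n - 3))` colorings, for graphs on `Fin n`. -/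
theorem exists_chromCount_sub_dpCoverCount_le (n : ℕ) (G : SimpleGraph (Fin n)) :
    ∃ C : ℕ, ∀ m : ℕ, n ≤ m → ∀ H : SimpleGraph (Fin n × Fin m), IsCover G m H →
      ((chromCount G m : ℤ) - dpCoverCount m H) * m ^ 3 ≤ C * m ^ n := by
  induction n with
  | zero =>
    refine ⟨0, fun m _ H _ => ?_⟩
    have h₁ : chromCount G m = 1 := by
      classical
      rw [chromCount_eq_card_filter]
      simp
    have h₂ : dpCoverCount m H = 1 := by
      classical
      rw [dpCoverCount_eq_card_filter]
      simp
    simp [h₁, h₂]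
  | succ n ih =>
    obtain ⟨C, hC⟩ := ih (G.comap Fin.succ)
    obtain ⟨d, C', hd, hC'⟩ := chromCount_sub_dpCoverCount_le_of_succ G
    refine ⟨C + C', fun m hm H hH => ?_⟩
    have h₁ := hC m (by omega) _ (hH.comap (Fin.succ_injective n))
    have h₂ := mul_le_mul_of_nonneg_right (hC' m H hH) (Int.natCast_nonneg m)
    have hmd : (0 : ℤ) ≤ (m : ℤ) - d := by omega
    have h₃ := mul_le_mul_of_nonneg_left h₁ hmd
    have h₄ : (0 : ℤ) ≤ d * (C * m ^ n) := by positivity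
    push_cast
    rw [pow_succ (m : ℤ) n]
    linarith

theorem stmt1 {V : Type} [Fintype V] (M : SimpleGraph V) (n : ℕ)
    (hn : Fintype.card V = n) :
    ∃ (C : ℝ) (N : ℕ), 0 < C ∧ ∀ m : ℕ, N ≤ m →
      0 ≤ (chromCount M m : ℝ) - (dpCount M m : ℝ) ∧
      (chromCount M m : ℝ) - (dpCount M m : ℝ) ≤ C * (m : ℝ) ^ ((n : ℤ) - 3) := by
  classical
  let e : Fin n ≃ V := (Fintype.equivFinOfCardEq hn).symm
  obtain ⟨C, hC⟩ := exists_chromCount_sub_dpCoverCount_le n (M.comap e)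
  refine ⟨C + 1, n + 1, by positivity, fun m hm => ?_⟩
  have hcanon : ∃ H, IsCover M m H ∧ dpCoverCount m H = chromCount M m :=
    ⟨_, isCover_canonicalCover M m, dpCoverCount_canonicalCover M m⟩
  constructor
  · rw [sub_nonneg, Nat.cast_le]
    exact Nat.sInf_le hcanon
  · obtain ⟨H, hH, hcount⟩ : dpCount M m ∈
        {c : ℕ | ∃ H : SimpleGraph (V × Fin m), IsCover M m H ∧ dpCoverCount m H = c} :=
      Nat.sInf_mem ⟨_, hcanon⟩
    have h := hC m (by omega) _ (hH.comap e.injective)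
    rw [chromCount_comap_equiv, dpCoverCount_comap_equiv, hcount] at h
    have h' : ((chromCount M m : ℝ) - dpCount M m) * (m : ℝ) ^ 3 ≤ C * (m : ℝ) ^ n := by
      exact_mod_cast h
    have hm0 : (0 : ℝ) < m := by
      exact_mod_cast (by omega : 0 < m)
    rw [zpow_sub₀ hm0.ne', zpow_natCast, ← mul_div_assoc,
      show (m : ℝ) ^ (3 : ℤ) = (m : ℝ) ^ 3 from zpow_natCast _ 3, le_div_iff₀ (by positivity)]
    refine h'.trans ?_
    gcongr
    linarith
end

section
/- Let G be a simple graph on n ≥ 3 vertices with s ≥ 3 edges whose girth (the length of a shortest cycle of G) is g, let m ∈ ℕ, and let H be a full m-fold cover of G. Then for every k with 1 ≤ k ≤ g−1 and every choice of k distinct edges e_{i_1}, …, e_{i_k} of G, the number of transversals I of H with I ∈ S_{e_{i_1}} ∩ ⋯ ∩ S_{e_{i_k}} equals m^{n−k}. -/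
/-- `H` is a full `m`-fold cover of `G`, on vertex set `V(G) × Fin m` with fiber
`{u} × Fin m` over `u`: fibers induce complete graphs, the cross-edges over each edge
of `G` form a perfect matching, and there are no other edges. -/
def IsFullCover {V : Type} (G : SimpleGraph V) (m : ℕ)
    (H : SimpleGraph (V × Fin m)) : Prop :=
  (∀ u : V, ∀ i j : Fin m, H.Adj (u, i) (u, j) ↔ i ≠ j) ∧
  (∀ u v : V, u ≠ v → ¬ G.Adj u v → ∀ i j : Fin m, ¬ H.Adj (u, i) (v, j)) ∧
  (∀ u v : V, G.Adj u v → ∀ i : Fin m, ∃! j : Fin m, H.Adj (u, i) (v, j))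

/-- The number of transversals `I` of `H` (sets picking exactly one vertex from each
fiber, i.e. graphs of functions `f : V → Fin m`) such that for each edge `uv ∈ E`, the
subgraph of `H` induced by `I` contains an edge joining the fibers of `u` and `v`;
that is, the number of elements of `⋂_{e ∈ E} S_e`. -/
noncomputable def coveredCount {V : Type} (m : ℕ) (H : SimpleGraph (V × Fin m))
    (E : Finset (Sym2 V)) : ℕ :=
  Nat.card {f : V → Fin m // ∀ e ∈ E, ∀ u v : V, e = s(u, v) → H.Adj (u, f u) (v, f v)}

/-- An acyclic graph on a finite vertex set with an edge has a leaf. -/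
theorem SimpleGraph.IsAcyclic.exists_leaf {V : Type*} [Finite V] {F : SimpleGraph V}
    (hF : F.IsAcyclic) {a b : V} (hab : F.Adj a b) :
    ∃ u v : V, F.Adj u v ∧ ∀ w, F.Adj u w → w = v := by
  have : Nonempty V := ⟨a⟩
  obtain ⟨u, v, p, hp, hmax⟩ := SimpleGraph.Walk.exists_isPath_forall_isPath_length_le_length F
  have hlen : 1 ≤ p.length := by
    simpa using hmax a b hab.toWalk (SimpleGraph.Walk.IsPath.of_adj hab)
  have hnil : ¬ p.Nil := by
    rw [← SimpleGraph.Walk.length_eq_zero_iff]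
    lia
  refine ⟨u, p.snd, p.adj_snd hnil, fun w hw => ?_⟩
  by_cases hmem : w ∈ p.support
  · exact hF.eq_snd_of_adj_start hp hw hmem
  · have := hmax w v (SimpleGraph.Walk.cons hw.symm p) (hp.cons hmem)
    simp at this

/-- A set of fewer edges than the girth spans no cycle. -/
theorem SimpleGraph.isAcyclic_fromEdgeSet_of_card_lt_egirth {V : Type*} {G : SimpleGraph V}
    {E : Finset (Sym2 V)} (hE : ↑E ⊆ G.edgeSet) (hcard : (E.card : ℕ∞) < G.egirth) :
    (SimpleGraph.fromEdgeSet (E : Set (Sym2 V))).IsAcyclic := by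
  classical
  intro a w hw
  have hle : SimpleGraph.fromEdgeSet (E : Set (Sym2 V)) ≤ G := by
    intro x y hxy
    exact hE ((SimpleGraph.fromEdgeSet_adj _).1 hxy).1
  have hlength : w.length ≤ E.card := by
    rw [← w.length_edges, ← List.toFinset_card_of_nodup hw.edges_nodup]
    refine Finset.card_le_card fun e he => ?_
    have := w.edges_subset_edgeSet (List.mem_toFinset.1 he)
    rw [SimpleGraph.edgeSet_fromEdgeSet] at this
    exact this.1
  have hgirth : G.egirth ≤ w.length :=
    (SimpleGraph.egirth_anti hle).trans (SimpleGraph.egirth_le_length hw)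
  exact absurd (hgirth.trans (by exact_mod_cast hlength)) (not_le.2 hcard)

/-- Deleting a pendant edge multiplies the number of covered transversals by `m`. -/
theorem IsFullCover.mul_coveredCount_insert {V : Type} [Fintype V] {G : SimpleGraph V} {m : ℕ}
    {H : SimpleGraph (V × Fin m)} (hH : IsFullCover G m H) [DecidableEq V]
    (E : Finset (Sym2 V)) {u v : V} (huv : G.Adj u v) (hu : ∀ e ∈ E, u ∉ e) :
    m * coveredCount m H (insert s(u, v) E) = coveredCount m H E := by
  choose j hj hjuniq using fun i => hH.2.2 v u huv.symm i
  have hvu : v ≠ u := huv.ne'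
  have hne : ∀ {x y : V}, s(x, y) ∈ E → x ≠ u ∧ y ≠ u := by
    intro x y he
    have := hu _ he
    simp only [Sym2.mem_iff, not_or] at this
    exact ⟨fun h => this.1 h.symm, fun h => this.2 h.symm⟩
  have hcongr : ∀ (f : V → Fin m) (i : Fin m),
      (∀ e ∈ E, ∀ x y : V, e = s(x, y) → H.Adj (x, f x) (y, f y)) →
      ∀ e ∈ E, ∀ x y : V, e = s(x, y) →
        H.Adj (x, Function.update f u i x) (y, Function.update f u i y) := by
    rintro f i hf e he x y rfl
    obtain ⟨hx, hy⟩ := hne he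
    rw [Function.update_of_ne hx, Function.update_of_ne hy]
    exact hf _ he x y rfl
  have e : Fin m × {f : V → Fin m // ∀ e ∈ insert s(u, v) E, ∀ x y : V, e = s(x, y) →
        H.Adj (x, f x) (y, f y)} ≃
      {f : V → Fin m // ∀ e ∈ E, ∀ x y : V, e = s(x, y) → H.Adj (x, f x) (y, f y)} :=
    { toFun := fun p => ⟨Function.update p.2.1 u p.1,
        hcongr _ _ fun e he => p.2.2 e (Finset.mem_insert_of_mem he)⟩
      invFun := fun f => ⟨f.1 u, Function.update f.1 u (j (f.1 v)), by
        intro e he x y hxy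
        rcases Finset.mem_insert.1 he with rfl | he
        · rcases Sym2.eq_iff.1 hxy with ⟨rfl, rfl⟩ | ⟨rfl, rfl⟩
          · rw [Function.update_self, Function.update_of_ne hvu]
            exact (hj _).symm
          · rw [Function.update_self, Function.update_of_ne hvu]
            exact hj _
        · exact hcongr _ _ f.2 e he x y hxy⟩
      left_inv := by
        rintro ⟨i, f, hf⟩
        have hfu : j (f v) = f u :=
          (hjuniq _ _ (hf _ (Finset.mem_insert_self _ _) v u Sym2.eq_swap)).symm
        simp [Function.update_of_ne hvu, hfu]
      right_inv := by
        rintro ⟨f, hf⟩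
        simp }
  simpa [coveredCount, Nat.card_prod] using Nat.card_congr e

/-- Each edge of a forest divides the number of covered transversals by `m`. -/
theorem IsFullCover.pow_card_mul_coveredCount {V : Type} [Fintype V] {G : SimpleGraph V} {m : ℕ}
    {H : SimpleGraph (V × Fin m)} (hH : IsFullCover G m H) (E : Finset (Sym2 V))
    (hE : ↑E ⊆ G.edgeSet) (hF : (SimpleGraph.fromEdgeSet (E : Set (Sym2 V))).IsAcyclic) :
    m ^ E.card * coveredCount m H E = m ^ Fintype.card V := by
  classical
  induction hk : E.card generalizing E with
  | zero =>
    obtain rfl := Finset.card_eq_zero.1 hk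
    simp [coveredCount]
  | succ k ih =>
    obtain ⟨e, he⟩ := Finset.card_pos.1 (by lia : 0 < E.card)
    induction e with | _ a b =>
    have hab : (SimpleGraph.fromEdgeSet (E : Set (Sym2 V))).Adj a b :=
      (SimpleGraph.fromEdgeSet_adj _).2 ⟨he, (hE he : G.Adj a b).ne⟩
    obtain ⟨u, v, huv, hleaf⟩ := hF.exists_leaf hab
    have huvE : s(u, v) ∈ E := ((SimpleGraph.fromEdgeSet_adj _).1 huv).1
    have hsub : E.erase s(u, v) ⊆ E := Finset.erase_subset _ _
    have hu : ∀ e ∈ E.erase s(u, v), u ∉ e := by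
      rintro e he ⟨w, rfl⟩
      have hw : (SimpleGraph.fromEdgeSet (E : Set (Sym2 V))).Adj u w :=
        (SimpleGraph.fromEdgeSet_adj _).2 ⟨hsub he, (hE (hsub he) : G.Adj u w).ne⟩
      exact Finset.ne_of_mem_erase he (by rw [hleaf w hw])
    have hmul := hH.mul_coveredCount_insert _ (hE huvE) hu
    rw [Finset.insert_erase huvE] at hmul
    have hrec := ih (E.erase s(u, v)) (fun e he => hE (hsub he))
      (hF.anti (SimpleGraph.fromEdgeSet_mono (by exact_mod_cast hsub)))
      (by rw [Finset.card_erase_of_mem huvE, hk]; rfl)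
    rw [pow_succ, mul_assoc, hmul, hrec]

/-- A finite girth is at most the number of vertices. -/
theorem SimpleGraph.le_card_of_egirth_eq {V : Type*} [Fintype V] {G : SimpleGraph V} {g : ℕ}
    (hg : G.egirth = g) : g ≤ Fintype.card V := by
  have hcyc : ¬ G.IsAcyclic := by
    rw [← SimpleGraph.egirth_eq_top, hg]
    exact ENat.natCast_ne_top g
  obtain ⟨a, w, hw, hlen⟩ := SimpleGraph.exists_egirth_eq_length.2 hcyc
  have hgw : g = w.length := by exact_mod_cast hg.symm.trans hlen
  have htail := hw.isPath_tail.length_lt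
  have := SimpleGraph.Walk.length_tail_add_one hw.not_nil
  lia

theorem stmt4 {V : Type} [Fintype V] (G : SimpleGraph V) (n sG g : ℕ)
    (hn : Fintype.card V = n) (hsG : G.edgeSet.ncard = sG)
    (hn3 : 3 ≤ n) (hs3 : 3 ≤ sG) (hgirth : G.egirth = (g : ℕ∞))
    (m : ℕ) (H : SimpleGraph (V × Fin m)) (hH : IsFullCover G m H)
    (k : ℕ) (hk1 : 1 ≤ k) (hkg : k ≤ g - 1)
    (E : Finset (Sym2 V)) (hE : ↑E ⊆ G.edgeSet) (hEcard : E.card = k) :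
    coveredCount m H E = m ^ (n - k) := by
  have hgn : g ≤ n := hn ▸ SimpleGraph.le_card_of_egirth_eq hgirth
  have hF := SimpleGraph.isAcyclic_fromEdgeSet_of_card_lt_egirth hE
    (by rw [hgirth, hEcard]; exact_mod_cast (by lia : k < g))
  have hmul := hH.pow_card_mul_coveredCount E hE hF
  rw [hEcard, hn] at hmul
  rcases Nat.eq_zero_or_pos m with rfl | hm
  · have : Nonempty V := Fintype.card_pos_iff.1 (by lia)
    rw [zero_pow (by lia)]
    simp [coveredCount]
  · refine Nat.eq_of_mul_eq_mul_left (pow_pos hm k) ?_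
    rw [hmul, ← pow_add, Nat.add_sub_cancel' (by lia)]
end

section
/- Let G be a simple graph on n ≥ 3 vertices with s ≥ 3 edges whose girth (the length of a shortest cycle of G) is g, let m ∈ ℕ, and let H be a full m-fold cover of G. Then for every choice of g distinct edges e_{i_1}, …, e_{i_g} of G, the number of transversals I of H with I ∈ S_{e_{i_1}} ∩ ⋯ ∩ S_{e_{i_g}} is at most m^{n−g+1}. -/
/-- A finite forest has at most `|V| - |E|` connected components. -/
theorem SimpleGraph.IsAcyclic.card_connectedComponent_add_ncard_edgeSet_le {V : Type*} [Finite V]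
    {F : SimpleGraph V} (hF : F.IsAcyclic) :
    Nat.card F.ConnectedComponent + F.edgeSet.ncard ≤ Nat.card V := by
  induction hk : F.edgeSet.ncard generalizing F with
  | zero =>
    exact Nat.card_le_card_of_surjective F.connectedComponentMk Quot.mk_surjective
  | succ k ih =>
    obtain ⟨e, he⟩ : F.edgeSet.Nonempty := by
      rw [← Set.ncard_pos]
      lia
    induction e using Sym2.ind with
    | _ u v =>
    have hle : F.deleteEdges {s(u, v)} ≤ F := F.deleteEdges_le _
    have hcard : (F.deleteEdges {s(u, v)}).edgeSet.ncard = k := by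
      rw [SimpleGraph.edgeSet_deleteEdges, Set.ncard_sdiff_singleton_of_mem he, hk,
        Nat.add_sub_cancel]
    have hcomp := ih (hF.anti hle) hcard
    have hnot : ¬ (F.deleteEdges {s(u, v)}).Reachable u v :=
      SimpleGraph.isAcyclic_iff_forall_adj_isBridge.mp hF he
    have hlt : Nat.card F.ConnectedComponent <
        Nat.card (F.deleteEdges {s(u, v)}).ConnectedComponent := by
      have hsurj := SimpleGraph.ConnectedComponent.surjective_map_ofLE hle
      refine lt_of_le_of_ne (Nat.card_le_card_of_surjective _ hsurj) fun heq ↦ hnot ?_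
      have hinj := (Nat.bijective_iff_surjective_and_card _).mpr ⟨hsurj, heq.symm⟩ |>.injective
      apply SimpleGraph.ConnectedComponent.exact
      apply hinj
      exact SimpleGraph.ConnectedComponent.sound (SimpleGraph.Adj.reachable he)
    lia

/-- A subgraph with fewer edges than the girth is a forest. -/
theorem SimpleGraph.isAcyclic_of_ncard_edgeSet_lt_egirth {V : Type*} [Finite V]
    {F G : SimpleGraph V} (hle : F ≤ G) (hlt : (F.edgeSet.ncard : ℕ∞) < G.egirth) :
    F.IsAcyclic := by
  classical
  intro a w hw
  have hgirth : G.egirth ≤ w.length :=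
    (SimpleGraph.egirth_anti hle).trans (SimpleGraph.egirth_le_length hw)
  have hlen : w.length ≤ F.edgeSet.ncard := by
    rw [← w.length_edges, ← List.toFinset_card_of_nodup hw.edges_nodup, ← Set.ncard_coe_finset]
    refine Set.ncard_le_ncard (fun e he ↦ ?_)
    exact w.edges_subset_edgeSet (by simpa using he)
  exact absurd (hlt.trans_le hgirth) (not_lt.mpr (by exact_mod_cast hlen))

/-- A transversal of a full cover whose selected vertices are adjacent along every edge of `E`
is determined by its values on representatives of the components of a subgraph of `G` with
edges in `E`. -/
theorem coveredCount_le_pow_card_connectedComponent {V : Type} [Finite V] {G : SimpleGraph V}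
    {m : ℕ} {H : SimpleGraph (V × Fin m)} (hH : IsFullCover G m H) {E : Finset (Sym2 V)}
    {F : SimpleGraph V} (hFG : F ≤ G) (hFE : F.edgeSet ⊆ E) :
    coveredCount m H E ≤ m ^ Nat.card F.ConnectedComponent := by
  have hcard : m ^ Nat.card F.ConnectedComponent = Nat.card (F.ConnectedComponent → Fin m) := by
    simp [Nat.card_fun]
  rw [hcard, coveredCount]
  refine Nat.card_le_card_of_injective (fun f c ↦ f.1 c.out) fun f f' hff' ↦ ?_
  have hwalk : ∀ {u v : V}, F.Walk u v → f.1 u = f'.1 u → f.1 v = f'.1 v := by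
    intro u v p
    induction p with
    | nil => exact id
    | @cons u v _ h _ ih =>
      intro huv
      refine ih ((hH.2.2 u v (hFG h) (f.1 u)).unique (f.2 _ (hFE h) u v rfl) ?_)
      rw [huv]
      exact f'.2 _ (hFE h) u v rfl
  refine Subtype.ext (funext fun v ↦ ?_)
  obtain ⟨p⟩ := SimpleGraph.ConnectedComponent.exact
    (Quot.out_eq (F.connectedComponentMk v))
  exact hwalk p (congrFun hff' _)

theorem stmt5 {V : Type} [Fintype V] (G : SimpleGraph V) (n sG g : ℕ)
    (hn : Fintype.card V = n) (hsG : G.edgeSet.ncard = sG)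
    (hn3 : 3 ≤ n) (hs3 : 3 ≤ sG) (hgirth : G.egirth = (g : ℕ∞))
    (m : ℕ) (H : SimpleGraph (V × Fin m)) (hH : IsFullCover G m H)
    (E : Finset (Sym2 V)) (hE : ↑E ⊆ G.edgeSet) (hEcard : E.card = g) :
    coveredCount m H E ≤ m ^ (n - g + 1) := by
  classical
  have hg : 3 ≤ g := by
    have h := G.three_le_egirth
    rw [hgirth] at h
    exact_mod_cast h
  obtain ⟨e, he⟩ : E.Nonempty := Finset.card_pos.mp (by lia)
  have hsub : (↑(E.erase e) : Set (Sym2 V)) ⊆ G.edgeSet :=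
    (Finset.coe_subset.mpr (E.erase_subset e)).trans hE
  set F := SimpleGraph.fromEdgeSet (↑(E.erase e) : Set (Sym2 V))
  have hedges : F.edgeSet = ↑(E.erase e) := by
    rw [SimpleGraph.edgeSet_fromEdgeSet, sdiff_eq_left]
    exact Set.disjoint_left.mpr fun x hx hx' ↦ G.not_isDiag_of_mem_edgeSet (hsub hx) hx'
  have hFG : F ≤ G := by
    rw [← SimpleGraph.edgeSet_subset_edgeSet, hedges]
    exact hsub
  have hncard : F.edgeSet.ncard = g - 1 := by
    rw [hedges, Set.ncard_coe_finset, Finset.card_erase_of_mem he, hEcard]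
  have hforest : F.IsAcyclic := by
    apply SimpleGraph.isAcyclic_of_ncard_edgeSet_lt_egirth hFG
    rw [hgirth, hncard]
    exact_mod_cast Nat.sub_one_lt (by lia)
  have hcomp := hforest.card_connectedComponent_add_ncard_edgeSet_le
  rw [hncard, Nat.card_eq_fintype_card (α := V), hn] at hcomp
  have : Nonempty V := Fintype.card_pos_iff.mp (by lia)
  have hpos : 0 < Nat.card F.ConnectedComponent := Nat.card_pos
  have hcount := coveredCount_le_pow_card_connectedComponent hH hFG
    (E := E) (hedges.subset.trans (Finset.coe_subset.mpr (E.erase_subset e)))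
  refine hcount.trans ?_
  rcases Nat.eq_zero_or_pos m with rfl | hm
  · simp
  · exact Nat.pow_le_pow_right hm (by lia)
end

section
/- Let G be a simple graph on n ≥ 3 vertices with s ≥ 3 edges whose girth (the length of a shortest cycle of G) is g, let m ∈ ℕ, and let H be a full m-fold cover of G. Then for every k ≥ g+1 and every choice of k distinct edges e_{i_1}, …, e_{i_k} of G, the number of transversals I of H with I ∈ S_{e_{i_1}} ∩ ⋯ ∩ S_{e_{i_k}} is at most m^{n−g}. -/
namespace SimpleGraph

/-- In a finite forest, some set of `|V| - |E|` vertices meets every component. -/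
theorem IsAcyclic.exists_finset_forall_reachable {V : Type*} [Fintype V] {T : SimpleGraph V}
    (hT : T.IsAcyclic) :
    ∃ S : Finset V, S.card + T.edgeSet.ncard = Fintype.card V ∧
      ∀ v, ∃ a ∈ S, T.Reachable v a := by
  classical
  induction hk : T.edgeSet.ncard generalizing T with
  | zero => exact ⟨Finset.univ, by simp, fun v ↦ ⟨v, by simp, .rfl⟩⟩
  | succ k ih =>
    obtain ⟨e, he⟩ : T.edgeSet.Nonempty := by
      rw [← Set.ncard_pos]; omega
    have hcard : (T.deleteEdges {e}).edgeSet.ncard = k := by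
      rw [edgeSet_deleteEdges, Set.ncard_sdiff_singleton_of_mem he, hk]; rfl
    obtain ⟨S, hS, hreach⟩ := ih (hT.anti (deleteEdges_le {e})) hcard
    have hmono {x y : V} (h : (T.deleteEdges {e}).Reachable x y) : T.Reachable x y :=
      h.mono (deleteEdges_le {e})
    have hb := isAcyclic_iff_forall_isBridge.1 hT he
    induction e with | _ u v
    rw [isBridge_iff] at hb
    obtain ⟨a, ha, hua⟩ := hreach u
    obtain ⟨b, hbS, hvb⟩ := hreach v
    have hab : a ≠ b := by
      rintro rfl
      exact hb (hua.trans hvb.symm)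
    refine ⟨S.erase b, ?_, fun w ↦ ?_⟩
    · have := Finset.card_erase_add_one hbS
      omega
    · obtain ⟨c, hc, hwc⟩ := hreach w
      by_cases hcb : c = b
      · subst hcb
        have huv : T.Adj u v := he
        exact ⟨a, by simp [hab, ha], ((hmono hwc).trans (hmono hvb).symm).trans
          (huv.symm.reachable.trans (hmono hua))⟩
      · exact ⟨c, by simp [hc, hcb], hmono hwc⟩

/-- Two open trails with the same edges have the same pair of endpoints. -/
theorem Walk.IsTrail.endpoints_eq_of_perm {V : Type*} {T : SimpleGraph V} {u v x y : V}
    {p : T.Walk u v} {q : T.Walk x y} (hp : p.IsTrail) (hq : q.IsTrail)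
    (hpq : p.edges.Perm q.edges) (huv : u ≠ v) (hxy : x ≠ y) : s(u, v) = s(x, y) := by
  classical
  have key (z : V) : (z ≠ u ∧ z ≠ v) ↔ (z ≠ x ∧ z ≠ y) := by
    have h₁ := hp.even_countP_edges_iff z
    have h₂ := hq.even_countP_edges_iff z
    rw [hpq.countP_eq] at h₁
    tauto
  have hu := key u
  have hv := key v
  rw [Sym2.eq_iff]
  grind

/-- In a graph without cycles shorter than `g`, the ends of an edge outside a spanning subgraph
`T` with the same reachability and fewer than `g` edges are joined by a path using all edges of `T`. -/
theorem exists_isPath_edges_eq {V : Type*} [Finite V] {F T : SimpleGraph V} {g : ℕ}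
    (hTF : T ≤ F) (hg : (g : ℕ∞) ≤ F.egirth) (hcard : T.edgeSet.ncard < g)
    (hreach : F.Reachable = T.Reachable) {u v : V} (huv : F.Adj u v) (hT : ¬ T.Adj u v) :
    ∃ p : T.Walk u v, p.IsPath ∧ {e | e ∈ p.edges} = T.edgeSet := by
  classical
  obtain ⟨p, hp⟩ : ∃ p : T.Walk u v, p.IsPath := by
    have h : T.Reachable u v := hreach ▸ huv.reachable
    exact h.exists_isPath
  refine ⟨p, hp, ?_⟩
  have hmem : s(v, u) ∉ (p.mapLe hTF).edges := by
    intro h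
    rw [Walk.edges_mapLe_eq_edges] at h
    exact hT (p.adj_of_mem_edges h).symm
  have hcyc : (Walk.cons huv.symm (p.mapLe hTF)).IsCycle :=
    (Walk.cons_isCycle_iff _ _).2 ⟨hp.mapLe hTF, hmem⟩
  have hlen := hg.trans (egirth_le_length hcyc)
  rw [Nat.cast_le, Walk.length_cons, Walk.length_map] at hlen
  refine Set.eq_of_subset_of_ncard_le (fun e he ↦ p.edges_subset_edgeSet he) ?_
    (Set.toFinite _)
  have : {e | e ∈ p.edges}.ncard = p.length := by
    rw [← List.coe_toFinset, Set.ncard_coe_finset,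
      List.toFinset_card_of_nodup hp.isTrail.edges_nodup, Walk.length_edges]
  omega

/-- A finite graph without cycles shorter than `g` and with more than `g` edges has a spanning
forest with at least `g` edges. -/
theorem exists_isAcyclic_le_of_lt_ncard_edgeSet {V : Type*} [Finite V] {F : SimpleGraph V} {g : ℕ}
    (hg : (g : ℕ∞) ≤ F.egirth) (hF : g < F.edgeSet.ncard) :
    ∃ T ≤ F, T.IsAcyclic ∧ g ≤ T.edgeSet.ncard := by
  classical
  obtain ⟨T, hTF, hT, hreach⟩ := F.exists_isAcyclic_reachable_eq_le
  refine ⟨T, hTF, hT, ?_⟩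
  by_contra! hcard
  have hdiff : 1 < (F.edgeSet \ T.edgeSet).ncard := by
    have := Set.ncard_sdiff_add_ncard_of_subset (edgeSet_mono hTF)
    omega
  obtain ⟨e, f, he, hf, hef⟩ := (Set.one_lt_ncard_iff (Set.toFinite _)).1 hdiff
  induction e with | _ u v
  induction f with | _ x y
  obtain ⟨p, hp, hpe⟩ := exists_isPath_edges_eq hTF hg hcard hreach.symm he.1 he.2
  obtain ⟨q, hq, hqe⟩ := exists_isPath_edges_eq hTF hg hcard hreach.symm hf.1 hf.2
  refine hef (hp.isTrail.endpoints_eq_of_perm hq.isTrail ?_ (Adj.ne he.1) (Adj.ne hf.1))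
  rw [List.perm_ext_iff_of_nodup hp.isTrail.edges_nodup hq.isTrail.edges_nodup]
  exact fun e ↦ Set.ext_iff.1 (hpe.trans hqe.symm) e

end SimpleGraph

theorem IsFullCover.eq_of_reachable {V : Type} {G T : SimpleGraph V} {m : ℕ}
    {H : SimpleGraph (V × Fin m)} (hH : IsFullCover G m H) (hTG : T ≤ G) {f f' : V → Fin m}
    (hf : ∀ u v, T.Adj u v → H.Adj (u, f u) (v, f v))
    (hf' : ∀ u v, T.Adj u v → H.Adj (u, f' u) (v, f' v)) {u v : V} (huv : T.Reachable u v)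
    (h : f v = f' v) : f u = f' u := by
  obtain ⟨p⟩ := huv
  induction p with
  | nil => exact h
  | cons hadj _ ih =>
    have hv := ih h
    refine (hH.2.2 _ _ (hTG hadj.symm) _).unique (hf _ _ hadj.symm) ?_
    rw [hv]
    exact hf' _ _ hadj.symm

theorem stmt7 {V : Type} [Fintype V] (G : SimpleGraph V) (n sG g : ℕ)
    (hn : Fintype.card V = n) (hsG : G.edgeSet.ncard = sG)
    (hn3 : 3 ≤ n) (hs3 : 3 ≤ sG) (hgirth : G.egirth = (g : ℕ∞))
    (m : ℕ) (H : SimpleGraph (V × Fin m)) (hH : IsFullCover G m H)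
    (k : ℕ) (hk : g + 1 ≤ k)
    (E : Finset (Sym2 V)) (hE : ↑E ⊆ G.edgeSet) (hEcard : E.card = k) :
    coveredCount m H E ≤ m ^ (n - g) := by
  classical
  have hFE : (SimpleGraph.fromEdgeSet (E : Set (Sym2 V))).edgeSet = E := by
    rw [SimpleGraph.edgeSet_fromEdgeSet]
    exact sdiff_eq_left.2 (Set.disjoint_left.2 fun e he hd ↦
      G.not_isDiag_of_mem_edgeSet (hE he) hd)
  have hFG : SimpleGraph.fromEdgeSet (E : Set (Sym2 V)) ≤ G := by
    rw [← SimpleGraph.edgeSet_subset_edgeSet, hFE]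
    exact hE
  obtain ⟨T, hTF, hT, hgT⟩ := SimpleGraph.exists_isAcyclic_le_of_lt_ncard_edgeSet
    (F := SimpleGraph.fromEdgeSet (E : Set (Sym2 V))) (g := g)
    (hgirth ▸ SimpleGraph.egirth_anti hFG) (by rw [hFE, Set.ncard_coe_finset]; omega)
  obtain ⟨S, hS, hreach⟩ := hT.exists_finset_forall_reachable
  have hTE {f : V → Fin m} (hf : ∀ e ∈ E, ∀ u v : V, e = s(u, v) → H.Adj (u, f u) (v, f v))
      (u v : V) (huv : T.Adj u v) : H.Adj (u, f u) (v, f v) :=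
    hf s(u, v) ((SimpleGraph.fromEdgeSet_adj _).1 (hTF huv)).1 u v rfl
  have hle : coveredCount m H E ≤ m ^ S.card := by
    have hinj : Function.Injective (fun (f : {f : V → Fin m // ∀ e ∈ E, ∀ u v : V,
        e = s(u, v) → H.Adj (u, f u) (v, f v)}) (a : S) ↦ f.1 a) := by
      rintro ⟨f, hf⟩ ⟨f', hf'⟩ h
      refine Subtype.ext (funext fun v ↦ ?_)
      obtain ⟨a, ha, hva⟩ := hreach v
      exact hH.eq_of_reachable (hTF.trans hFG) (hTE hf) (hTE hf') hva (congrFun h ⟨a, ha⟩)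
    simpa [coveredCount] using Nat.card_le_card_of_injective _ hinj
  rcases Nat.eq_zero_or_pos m with rfl | hm
  · obtain ⟨v⟩ : Nonempty V := Fintype.card_pos_iff.1 (by omega)
    have : IsEmpty (V → Fin 0) := ⟨fun f ↦ (f v).elim0⟩
    simp [coveredCount]
  · exact hle.trans (Nat.pow_le_pow_right hm (by omega))
end

section
/- Let g be an odd integer with g ≥ 3, and let G be a simple graph on n ≥ 3 vertices with s ≥ 3 edges whose girth (the length of a shortest cycle of G) is g or g+1, and let t be the number of cycles of length g in G. Then for every m ∈ ℕ and every full m-fold cover H of G, the number of independent transversals of H is at least (C(s,g−1) − t)·m^{n−g+1} + Σ_{i=0}^{g−2} (−1)^i·C(s,i)·m^{n−i} − (C(s,g) − t)·m^{n−g} − 2^s·m^{n−g}, where C(s,i) denotes the binomial coefficient s choose i (the inequality understood in the integers/reals). -/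
/-- The number of independent transversals of `H`: independent sets of `H` picking
exactly one vertex from each fiber (i.e. graphs of functions `f`). -/
noncomputable def indepTransCount {W : Type} (m : ℕ)
    (H : SimpleGraph (W × Fin m)) : ℕ :=
  Nat.card {f : W → Fin m // ∀ p q : W, ¬ H.Adj (p, f p) (q, f q)}

/-- The number of cycles of length `g` in a graph `M` (a cycle being determined by its
edge set). -/
noncomputable def cycleCount {W : Type} [DecidableEq W] (M : SimpleGraph W) (g : ℕ) : ℕ :=
  Nat.card {A : Finset (Sym2 W) // ∃ (v : W) (c : M.Walk v v),
    c.IsCycle ∧ c.length = g ∧ c.edges.toFinset = A}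


section

open Finset

namespace SimpleGraph

variable {V : Type}

lemma IsAcyclic.exists_leaf_s14 [Finite V] {Γ : SimpleGraph V} (h : Γ.IsAcyclic) (hne : Γ ≠ ⊥) :
    ∃ u w, Γ.Adj u w ∧ ∀ x, Γ.Adj u x → x = w := by
  obtain ⟨a, b, hab⟩ := SimpleGraph.ne_bot_iff_exists_adj.mp hne
  have : Nonempty V := ⟨a⟩
  obtain ⟨u, v, p, hp, hmax⟩ :=
    Walk.exists_isPath_forall_isPath_length_le_length Γ
  have hlen : 1 ≤ p.length := by
    simpa using hmax a b hab.toWalk (Walk.IsPath.of_adj hab)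
  have hnil : ¬ p.Nil := by
    rw [← Walk.length_eq_zero_iff]; omega
  refine ⟨u, p.snd, p.adj_snd hnil, fun w hadj ↦ h.eq_snd_of_adj_start hp hadj ?_⟩
  by_contra hw
  have := hmax _ _ (p.cons hadj.symm) (hp.cons hw)
  simp at this

lemma IsAcyclic.card_lt_card [Fintype V] [Nonempty V] {F : Finset (Sym2 V)}
    (hF : ∀ e ∈ F, ¬ e.IsDiag)
    (h : (fromEdgeSet (F : Set (Sym2 V))).IsAcyclic) : #F < Fintype.card V := by
  classical
  obtain ⟨T, hFT, -, hT⟩ :=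
    (connected_top (V := V)).exists_isTree_le_of_le_of_isAcyclic le_top h
  have hsub : F ⊆ T.edgeFinset := by
    intro e he
    rw [mem_edgeFinset]
    refine edgeSet_mono hFT ?_
    rw [edgeSet_fromEdgeSet]
    exact ⟨he, hF e he⟩
  have := card_le_card hsub
  have := hT.card_edgeFinset
  omega

variable {G : SimpleGraph V} {A : Finset (Sym2 V)} {g : ℕ}

lemma exists_isCycle_edges_subset [DecidableEq V] (hA : (A : Set (Sym2 V)) ⊆ G.edgeSet)
    (h : ¬ (fromEdgeSet (A : Set (Sym2 V))).IsAcyclic) :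
    ∃ (v : V) (c : G.Walk v v), c.IsCycle ∧ c.edges.toFinset ⊆ A := by
  simp only [IsAcyclic, not_forall, not_not] at h
  obtain ⟨v, c, hc⟩ := h
  have hle : fromEdgeSet (A : Set (Sym2 V)) ≤ G := by
    intro a b hab
    exact hA ((fromEdgeSet_adj _).mp hab).1
  refine ⟨v, c.mapLe hle, hc.mapLe hle, fun e he ↦ ?_⟩
  rw [List.mem_toFinset, Walk.edges_mapLe_eq_edges] at he
  have := c.edges_subset_edgeSet he
  rw [edgeSet_fromEdgeSet] at this
  exact this.1

lemma Walk.IsCycle.card_edges_toFinset [DecidableEq V] {v : V} {c : G.Walk v v} (hc : c.IsCycle) :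
    #c.edges.toFinset = c.length := by
  rw [List.toFinset_card_of_nodup hc.edges_nodup, Walk.length_edges]

lemma Walk.IsCycle.le_length (hg : (g : ℕ∞) ≤ G.egirth) {v : V} {c : G.Walk v v}
    (hc : c.IsCycle) : g ≤ c.length := by
  exact_mod_cast hg.trans (egirth_le_length hc)

lemma le_card_of_egirth_ne_top [Fintype V] (hg : (g : ℕ∞) ≤ G.egirth) (h : G.egirth ≠ ⊤) :
    g ≤ Fintype.card V := by
  rw [Ne, egirth_eq_top] at h
  obtain ⟨v, c, hc⟩ : ∃ (v : V) (c : G.Walk v v), c.IsCycle := by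
    simpa [IsAcyclic] using h
  have := hc.support_nodup.length_le_card
  simp only [List.length_tail, Walk.length_support, Nat.add_sub_cancel] at this
  exact (hc.le_length hg).trans this

variable [DecidableEq V]

lemma Walk.IsCycle.even_card_filter_mem {v : V} {c : G.Walk v v} (hc : c.IsCycle) (u : V) :
    Even #{e ∈ c.edges.toFinset | u ∈ e} := by
  have := (hc.isTrail.even_countP_edges_iff u).mpr (by simp)
  rw [List.countP_eq_length_filter, ← List.toFinset_card_of_nodup (hc.edges_nodup.filter _),
    List.toFinset_filter] at this
  simpa only [decide_eq_true_eq] using this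

lemma isAcyclic_fromEdgeSet_of_card_lt (hg : (g : ℕ∞) ≤ G.egirth)
    (hA : (A : Set (Sym2 V)) ⊆ G.edgeSet) (hcard : #A < g) :
    (fromEdgeSet (A : Set (Sym2 V))).IsAcyclic := by
  by_contra h
  obtain ⟨v, c, hc, hcA⟩ := exists_isCycle_edges_subset hA h
  have := card_le_card hcA
  rw [hc.card_edges_toFinset] at this
  have := hc.le_length hg
  omega

lemma exists_isCycle_edges_eq (hg : (g : ℕ∞) ≤ G.egirth)
    (hA : (A : Set (Sym2 V)) ⊆ G.edgeSet) (hcard : #A = g)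
    (h : ¬ (fromEdgeSet (A : Set (Sym2 V))).IsAcyclic) :
    ∃ (v : V) (c : G.Walk v v), c.IsCycle ∧ c.length = g ∧ c.edges.toFinset = A := by
  obtain ⟨v, c, hc, hcA⟩ := exists_isCycle_edges_subset hA h
  have hlen := hc.le_length hg
  have heq : c.edges.toFinset = A :=
    eq_of_subset_of_card_le hcA (by rw [hc.card_edges_toFinset]; omega)
  refine ⟨v, c, hc, ?_, heq⟩
  rw [← hc.card_edges_toFinset, heq, hcard]

/-- More than `g` edges in a graph of girth at least `g` contain a forest with `g` edges: two
cycles of length `g` cannot differ in a single edge, by parity of degrees. -/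
lemma exists_subset_isAcyclic_of_lt_card (hg : (g : ℕ∞) ≤ G.egirth) (hg0 : 0 < g)
    (hA : (A : Set (Sym2 V)) ⊆ G.edgeSet) (hcard : g < #A) :
    ∃ F ⊆ A, #F = g ∧ (fromEdgeSet (F : Set (Sym2 V))).IsAcyclic := by
  obtain ⟨B, hBA, hB⟩ := exists_subset_card_eq (Nat.succ_le_of_lt hcard)
  by_contra! hcon
  have heven : ∀ e ∈ B, ∀ u, Even #{x ∈ B.erase e | u ∈ x} := by
    intro e he u
    have hsub : B.erase e ⊆ A := (erase_subset _ _).trans hBA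
    have hc : #(B.erase e) = g := by rw [card_erase_of_mem he, hB]; rfl
    obtain ⟨v, c, hcyc, -, hceq⟩ := exists_isCycle_edges_eq hg
      ((coe_subset.mpr hsub).trans hA) hc (hcon _ hsub hc)
    rw [← hceq]
    exact hcyc.even_card_filter_mem u
  obtain ⟨e, he, f, hf, hef⟩ := one_lt_card.mp (show 1 < #B by omega)
  obtain ⟨u, hue, huf⟩ : ∃ u, u ∈ e ∧ u ∉ f := by
    by_contra! h
    induction e with
    | _ a b =>
      have hab : a ≠ b := Adj.ne (G := G) (hA (hBA he))
      exact hef ((Sym2.mem_and_mem_iff hab).mp ⟨h a (by simp), h b (by simp)⟩).symm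
  have h1 := heven e he u
  have h2 := heven f hf u
  rw [filter_erase, card_erase_of_mem (by simp [he, hue])] at h1
  rw [filter_erase, erase_eq_of_notMem (by simp [huf])] at h2
  have : 0 < #{x ∈ B | u ∈ x} := card_pos.mpr ⟨e, by simp [he, hue]⟩
  rw [Nat.even_iff] at h1 h2
  omega

end SimpleGraph

namespace IsFullCover

variable {V : Type} {G : SimpleGraph V} {m : ℕ}
  {H : SimpleGraph (V × Fin m)}

lemma coveredCount_empty [Fintype V] [DecidableEq V] : coveredCount m H ∅ = m ^ Fintype.card V := by
  unfold coveredCount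
  simp [Nat.card_eq_fintype_card]

lemma coveredCount_anti [Finite V] {A B : Finset (Sym2 V)} (h : A ⊆ B) :
    coveredCount m H B ≤ coveredCount m H A :=
  Nat.card_le_card_of_injective
    (fun f ↦ ⟨f.1, fun e he ↦ f.2 e (h he)⟩) fun f g hfg ↦ Subtype.ext (by simpa using hfg)

/-- Adding a pendant edge divides the number of covering transversals by `m`. -/
lemma coveredCount_mul_of_leaf [DecidableEq V] (hH : IsFullCover G m H) {F : Finset (Sym2 V)} {u w : V}
    (huw : G.Adj u w) (hmem : s(u, w) ∈ F) (hleaf : ∀ e ∈ F, u ∈ e → e = s(u, w)) :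
    coveredCount m H F * m = coveredCount m H (F.erase s(u, w)) := by
  choose σ hσ hσu using hH.2.2 w u huw.symm
  have hne : w ≠ u := huw.ne'
  have hnotin : ∀ {a b}, s(a, b) ∈ F.erase s(u, w) → a ≠ u ∧ b ≠ u := by
    intro a b hab
    rw [mem_erase] at hab
    constructor <;> rintro rfl <;> exact hab.1 (hleaf _ hab.2 (by simp))
  unfold coveredCount
  have hprod (α : Type) : Nat.card α * m = Nat.card (α × Fin m) := by
    rw [Nat.card_prod, Nat.card_fin]
  rw [hprod]
  refine Nat.card_congr ⟨fun p ↦ ⟨Function.update p.1.1 u p.2, ?_⟩,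
    fun f ↦ (⟨Function.update f.1 u (σ (f.1 w)), ?_⟩, f.1 u), ?_, ?_⟩
  · rintro e he a b rfl
    obtain ⟨ha, hb⟩ := hnotin he
    simpa [ha, hb] using p.1.2 _ (mem_of_mem_erase he) a b rfl
  · rintro e he a b rfl
    by_cases hab : s(a, b) = s(u, w)
    · rw [Sym2.eq_iff] at hab
      obtain ⟨rfl, rfl⟩ | ⟨rfl, rfl⟩ := hab
      · simpa [hne] using (hσ (f.1 b)).symm
      · simpa [hne] using hσ (f.1 a)
    · have he' : s(a, b) ∈ F.erase s(u, w) := mem_erase.mpr ⟨hab, he⟩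
      obtain ⟨ha, hb⟩ := hnotin he'
      simpa [ha, hb] using f.2 _ he' a b rfl
  · rintro ⟨⟨f, hf⟩, i⟩
    have : σ (f w) = f u := (hσu _ _ (hf _ hmem u w rfl).symm).symm
    simp [hne, this]
  · rintro ⟨f, hf⟩
    simp

lemma coveredCount_of_isAcyclic [Fintype V] [DecidableEq V] [Nonempty V] (hH : IsFullCover G m H) {F : Finset (Sym2 V)}
    (hFG : (F : Set (Sym2 V)) ⊆ G.edgeSet)
    (h : (SimpleGraph.fromEdgeSet (F : Set (Sym2 V))).IsAcyclic) :
    coveredCount m H F = m ^ (Fintype.card V - #F) := by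
  induction hk : #F generalizing F with
  | zero =>
    rw [card_eq_zero] at hk
    simp [hk, coveredCount_empty]
  | succ k ih =>
    have hlt : #F < Fintype.card V := h.card_lt_card fun e he ↦ G.not_isDiag_of_mem_edgeSet (hFG he)
    obtain ⟨e, he⟩ : F.Nonempty := by rw [← card_pos]; omega
    have hbot : SimpleGraph.fromEdgeSet (F : Set (Sym2 V)) ≠ ⊥ := by
      intro hb
      have : e ∈ (SimpleGraph.fromEdgeSet (F : Set (Sym2 V))).edgeSet := by
        rw [SimpleGraph.edgeSet_fromEdgeSet]
        exact ⟨he, G.not_isDiag_of_mem_edgeSet (hFG he)⟩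
      simp [hb] at this
    obtain ⟨u, w, huw, hleaf⟩ := h.exists_leaf_s14 hbot
    rw [SimpleGraph.fromEdgeSet_adj] at huw
    have hmul := hH.coveredCount_mul_of_leaf (hFG huw.1) huw.1 (by
      intro e' he' hu
      obtain ⟨x, rfl⟩ := Sym2.mem_iff_exists.mp hu
      rw [hleaf x ((SimpleGraph.fromEdgeSet_adj _).mpr
        ⟨he', SimpleGraph.Adj.ne (G := G) (hFG he')⟩)])
    rw [ih (F := F.erase s(u, w)) ((coe_subset.mpr (erase_subset _ _)).trans hFG)
      (h.anti (SimpleGraph.fromEdgeSet_mono (coe_subset.mpr (erase_subset _ _))))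
      (by rw [card_erase_of_mem huw.1]; omega)] at hmul
    obtain rfl | hm := m.eq_zero_or_pos
    · have : IsEmpty (V → Fin 0) := inferInstance
      rw [zero_pow (by omega)]
      simp [coveredCount]
    · apply Nat.eq_of_mul_eq_mul_right hm
      rw [hmul, ← pow_succ]
      congr 1
      omega

end IsFullCover

namespace IsFullCover

open SimpleGraph

variable {V : Type} [Fintype V] [DecidableEq V] {G : SimpleGraph V} {m : ℕ}
  {H : SimpleGraph (V × Fin m)}

lemma indepTransCount_eq_sum [DecidableRel G.Adj] (hH : IsFullCover G m H) :
    (indepTransCount m H : ℤ) =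
      ∑ A ∈ G.edgeFinset.powerset, (-1 : ℤ) ^ #A * coveredCount m H A := by
  classical
  let S (e : Sym2 V) : Finset (V → Fin m) :=
    {f | ∀ u v, e = s(u, v) → H.Adj (u, f u) (v, f v)}
  have hcov (A : Finset (Sym2 V)) : coveredCount m H A = #(A.inf S) := by
    rw [coveredCount, Nat.subtype_card]
    simp [S, mem_inf]
  have hindep : indepTransCount m H = #(G.edgeFinset.inf fun e ↦ (S e)ᶜ) := by
    rw [indepTransCount, Nat.subtype_card]
    intro f
    simp only [mem_inf, mem_edgeFinset, mem_compl, S, mem_filter, mem_univ, true_and]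
    constructor
    · intro h p q hpq
      by_cases hG : G.Adj p q
      · refine h s(p, q) hG fun u v huv ↦ ?_
        obtain ⟨rfl, rfl⟩ | ⟨rfl, rfl⟩ := Sym2.eq_iff.mp huv
        · exact hpq
        · exact hpq.symm
      · by_cases hne : p = q
        · subst hne
          exact H.irrefl hpq
        · exact hH.2.1 p q hne hG _ _ hpq
    · intro h e he hall
      induction e with
      | _ a b => exact h a b (hall a b rfl)
  rw [hindep, inclusion_exclusion_card_inf_compl]
  simp [hcov]

lemma coveredCount_le_of_subset_isAcyclic [Nonempty V] (hH : IsFullCover G m H)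
    {A F : Finset (Sym2 V)} (hA : (A : Set (Sym2 V)) ⊆ G.edgeSet) (hFA : F ⊆ A)
    (hF : (fromEdgeSet (F : Set (Sym2 V))).IsAcyclic) :
    coveredCount m H A ≤ m ^ (Fintype.card V - #F) :=
  (coveredCount_anti hFA).trans_eq
    (hH.coveredCount_of_isAcyclic ((coe_subset.mpr hFA).trans hA) hF)

open scoped Classical in
/-- Lower bound for a single inclusion-exclusion term when the girth is at least the odd
number `g`. -/
lemma le_neg_one_pow_mul_coveredCount [Nonempty V] (hH : IsFullCover G m H) {g : ℕ}
    (hodd : Odd g) (hg : (g : ℕ∞) ≤ G.egirth) (hgn : g ≤ Fintype.card V)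
    {A : Finset (Sym2 V)} (hA : (A : Set (Sym2 V)) ⊆ G.edgeSet) :
    (if #A < g then (-1 : ℤ) ^ #A * (m : ℤ) ^ (Fintype.card V - #A) else 0)
      - (if ∃ (v : V) (c : G.Walk v v), c.IsCycle ∧ c.length = g ∧ c.edges.toFinset = A
          then (m : ℤ) ^ (Fintype.card V - g + 1) else 0)
      - (if #A = g ∧ ¬ ∃ (v : V) (c : G.Walk v v),
          c.IsCycle ∧ c.length = g ∧ c.edges.toFinset = A
          then (m : ℤ) ^ (Fintype.card V - g) else 0)
      - (m : ℤ) ^ (Fintype.card V - g) ≤ (-1 : ℤ) ^ #A * coveredCount m H A := by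
  have hpos : 0 < g := hodd.pos
  have hnn (k : ℕ) : (0 : ℤ) ≤ (m : ℤ) ^ k := by positivity
  have hle {F : Finset (Sym2 V)} (hFA : F ⊆ A)
      (hF : (fromEdgeSet (F : Set (Sym2 V))).IsAcyclic) :
      (coveredCount m H A : ℤ) ≤ (m : ℤ) ^ (Fintype.card V - #F) := by
    exact_mod_cast hH.coveredCount_le_of_subset_isAcyclic hA hFA hF
  obtain hlt | heq | hgt := lt_trichotomy #A g
  · have hac := isAcyclic_fromEdgeSet_of_card_lt hg hA hlt
    rw [if_pos hlt, hH.coveredCount_of_isAcyclic hA hac, Nat.cast_pow]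
    have := hnn (Fintype.card V - g)
    have := hnn (Fintype.card V - g + 1)
    split_ifs <;> linarith
  · rw [if_neg heq.not_lt, heq, hodd.neg_one_pow]
    by_cases hcyc : ∃ (v : V) (c : G.Walk v v),
        c.IsCycle ∧ c.length = g ∧ c.edges.toFinset = A
    · rw [if_pos hcyc, if_neg fun h ↦ h.2 hcyc]
      obtain ⟨F, hFA, hF⟩ := exists_subset_card_eq (show g - 1 ≤ #A by omega)
      have := hle hFA (isAcyclic_fromEdgeSet_of_card_lt hg
        ((coe_subset.mpr hFA).trans hA) (by omega))
      rw [hF, show Fintype.card V - (g - 1) = Fintype.card V - g + 1 by omega] at this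
      linarith [hnn (Fintype.card V - g)]
    · rw [if_neg hcyc, if_pos ⟨rfl, hcyc⟩]
      have hac : (fromEdgeSet (A : Set (Sym2 V))).IsAcyclic := by
        by_contra h
        exact hcyc (exists_isCycle_edges_eq hg hA heq h)
      have := hle subset_rfl hac
      rw [heq] at this
      linarith [hnn (Fintype.card V - g)]
  · have hcyc : ¬ ∃ (v : V) (c : G.Walk v v),
        c.IsCycle ∧ c.length = g ∧ c.edges.toFinset = A := by
      rintro ⟨v, c, hc, hlen, rfl⟩
      rw [hc.card_edges_toFinset] at hgt
      omega
    rw [if_neg hgt.not_gt, if_neg hcyc, if_neg (by omega)]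
    obtain ⟨F, hFA, hF, hac⟩ := exists_subset_isAcyclic_of_lt_card hg hpos hA hgt
    have := hle hFA hac
    rw [hF] at this
    have h0 : (0 : ℤ) ≤ coveredCount m H A := by positivity
    obtain h | h := neg_one_pow_eq_or ℤ #A <;> rw [h] <;> linarith

end IsFullCover

lemma Finset.sum_powerset_ite_card_lt {α : Type*} (s : Finset α) (g : ℕ) (f : ℕ → ℤ) :
    ∑ A ∈ s.powerset, (if #A < g then f #A else 0) =
      ∑ i ∈ range g, ((#s).choose i : ℤ) * f i := by
  rw [sum_powerset_apply_card (fun k ↦ if k < g then f k else 0)]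
  simp only [nsmul_eq_mul, mul_ite, mul_zero]
  rw [← sum_filter]
  refine sum_subset (fun i hi ↦ by simp at hi ⊢; exact hi.2) fun i hi hni ↦ ?_
  simp only [mem_filter, mem_range] at hi hni
  rw [Nat.choose_eq_zero_of_lt (by omega)]
  simp

end

theorem stmt14 {V : Type} [Fintype V] [DecidableEq V] (G : SimpleGraph V) (n sG g : ℕ)
    (hn : Fintype.card V = n) (hsG : G.edgeSet.ncard = sG)
    (hn3 : 3 ≤ n) (hs3 : 3 ≤ sG)
    (hg : 3 ≤ g) (hodd : Odd g)
    (hgirth : G.egirth = (g : ℕ∞) ∨ G.egirth = (g : ℕ∞) + 1)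
    (m : ℕ) (H : SimpleGraph (V × Fin m)) (hH : IsFullCover G m H) :
    ((sG.choose (g - 1) : ℤ) - (cycleCount G g : ℤ)) * (m : ℤ) ^ (n - g + 1)
        + ∑ i ∈ Finset.range (g - 1), (-1 : ℤ) ^ i * (sG.choose i : ℤ) * (m : ℤ) ^ (n - i)
        - ((sG.choose g : ℤ) - (cycleCount G g : ℤ)) * (m : ℤ) ^ (n - g)
        - 2 ^ sG * (m : ℤ) ^ (n - g) ≤
      (indepTransCount m H : ℤ) := by
  classical
  subst hn
  have : Nonempty V := Fintype.card_pos_iff.mp (by omega)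
  have hle : (g : ℕ∞) ≤ G.egirth := by
    obtain h | h := hgirth <;> rw [h]
    exact le_self_add
  have hgn : g ≤ Fintype.card V := by
    refine SimpleGraph.le_card_of_egirth_ne_top hle ?_
    obtain h | h := hgirth <;> rw [h]
    · exact ENat.natCast_ne_top g
    · exact_mod_cast ENat.natCast_ne_top (g + 1)
  have hcard : G.edgeFinset.card = sG := by
    rw [← hsG, Set.ncard_eq_toFinset_card']
    rfl
  let cyc (A : Finset (Sym2 V)) : Prop := ∃ (v : V) (c : G.Walk v v),
    c.IsCycle ∧ c.length = g ∧ c.edges.toFinset = A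
  have hcycE {A : Finset (Sym2 V)} (h : cyc A) : A ⊆ G.edgeFinset ∧ A.card = g := by
    obtain ⟨v, c, hc, hlen, rfl⟩ := h
    refine ⟨fun e he ↦ ?_, hc.card_edges_toFinset.trans hlen⟩
    exact SimpleGraph.mem_edgeFinset.mpr (c.edges_subset_edgeSet (List.mem_toFinset.mp he))
  have hcount : (G.edgeFinset.powerset.filter cyc).card = cycleCount G g := by
    rw [cycleCount, Nat.subtype_card]
    intro A
    rw [Finset.mem_filter, Finset.mem_powerset]
    exact ⟨fun h ↦ h.2, fun h ↦ ⟨(hcycE h).1, h⟩⟩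
  have hcompl : ((G.edgeFinset.powerset.filter fun A ↦ A.card = g ∧ ¬ cyc A).card : ℤ) =
      sG.choose g - cycleCount G g := by
    have h := Finset.card_filter_add_card_filter_not (s := G.edgeFinset.powersetCard g) cyc
    rw [Finset.card_powersetCard, hcard] at h
    have h1 : (G.edgeFinset.powersetCard g).filter cyc = G.edgeFinset.powerset.filter cyc := by
      ext A
      simp only [Finset.mem_filter, Finset.mem_powersetCard, Finset.mem_powerset]
      exact ⟨fun h ↦ ⟨h.1.1, h.2⟩, fun h ↦ ⟨⟨h.1, (hcycE h.2).2⟩, h.2⟩⟩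
    have h2 : (G.edgeFinset.powersetCard g).filter (fun A ↦ ¬ cyc A) =
        G.edgeFinset.powerset.filter fun A ↦ A.card = g ∧ ¬ cyc A := by
      ext A
      simp only [Finset.mem_filter, Finset.mem_powersetCard, Finset.mem_powerset]
      tauto
    rw [h1, h2, hcount] at h
    omega
  have hsum := Finset.sum_le_sum fun A (hA : A ∈ G.edgeFinset.powerset) ↦
    hH.le_neg_one_pow_mul_coveredCount hodd hle hgn (A := A) (by
      rw [← SimpleGraph.coe_edgeFinset]
      exact Finset.coe_subset.mpr (Finset.mem_powerset.mp hA))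
  rw [← hH.indepTransCount_eq_sum] at hsum
  refine le_of_eq_of_le ?_ hsum
  simp only [Finset.sum_sub_distrib]
  rw [Finset.sum_powerset_ite_card_lt _ g
      (fun k ↦ (-1 : ℤ) ^ k * (m : ℤ) ^ (Fintype.card V - k)),
    ← Finset.sum_filter, ← Finset.sum_filter, Finset.sum_const, Finset.sum_const,
    Finset.sum_const, Finset.card_powerset, hcard, hcount]
  simp only [nsmul_eq_mul]
  rw [hcompl]
  obtain ⟨k, rfl⟩ : ∃ k, g = k + 1 := ⟨g - 1, by omega⟩
  have hk : Even k := by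
    rw [Nat.odd_add_one, Nat.not_odd_iff_even] at hodd
    exact hodd
  rw [Finset.sum_range_succ, hk.neg_one_pow, Nat.add_sub_cancel,
    show Fintype.card V - k = Fintype.card V - (k + 1) + 1 by omega]
  have hs : ∑ i ∈ Finset.range k, (sG.choose i : ℤ) * ((-1) ^ i * (m : ℤ) ^ (Fintype.card V - i))
      = ∑ i ∈ Finset.range k, (-1 : ℤ) ^ i * (sG.choose i : ℤ) * (m : ℤ) ^ (Fintype.card V - i) :=
    Finset.sum_congr rfl fun i _ ↦ by ring
  rw [hs]
  push_cast
  ring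
end
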